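/- arXiv:math/0206271 — 2 statements merged into one kernel-verified Lean document; each statement's English description precedes it below -/
import Mathlib

section
/- Each of the bidifferential operators P − S, Q − S and R − S is regular. That is, each of P − S, Q − S and R − S can be written in the form (φ,ψ) ↦ Σ b^{l̄₁…l̄_β k₁…k_α} (∂̄_{l₁}…∂̄_{l_β} φ)(∂_{k₁}…∂_{k_α} ψ) with finitely many terms, where every coefficient function b is regular (Proposition 1 of the paper). -/
open scoped BigOperators

noncomputable section

/-- The `k`-th standard basis vector of `ℂⁿ`. -/
def ebasis (n : ℕ) (k : Fin n) : Fin n → ℂ := Pi.single k 1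

/-- The holomorphic Wirtinger derivative `∂ₖ f`, computed via the real Fréchet derivative:
`∂ₖ f (z) = (1/2) (Df(z)(eₖ) - i · Df(z)(i·eₖ))`. -/
def wdP (n : ℕ) (k : Fin n) (f : (Fin n → ℂ) → ℂ) : (Fin n → ℂ) → ℂ :=
  fun z => (1 / 2 : ℂ) *
    (fderiv ℝ f z (ebasis n k) - Complex.I * fderiv ℝ f z (Complex.I • ebasis n k))

/-- The antiholomorphic Wirtinger derivative `∂̄ₖ f`:
`∂̄ₖ f (z) = (1/2) (Df(z)(eₖ) + i · Df(z)(i·eₖ))`. -/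
def wdB (n : ℕ) (k : Fin n) (f : (Fin n → ℂ) → ℂ) : (Fin n → ℂ) → ℂ :=
  fun z => (1 / 2 : ℂ) *
    (fderiv ℝ f z (ebasis n k) + Complex.I * fderiv ℝ f z (Complex.I • ebasis n k))

/-- The Kähler potential viewed as a complex valued function. -/
def Phic (n : ℕ) (Φ : (Fin n → ℂ) → ℝ) : (Fin n → ℂ) → ℂ := fun z => (Φ z : ℂ)

/-- The metric `g_{k l̄} = ∂_k ∂̄_l Φ`. -/
def gdn (n : ℕ) (Φ : (Fin n → ℂ) → ℝ) (k l : Fin n) : (Fin n → ℂ) → ℂ :=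
  wdP n k (wdB n l (Phic n Φ))

/-- `g_{k p t̄} = ∂_k ∂_p ∂̄_t Φ`. -/
def g3h (n : ℕ) (Φ : (Fin n → ℂ) → ℝ) (k p t : Fin n) : (Fin n → ℂ) → ℂ :=
  wdP n k (wdP n p (wdB n t (Phic n Φ)))

/-- `g_{s q̄ l̄} = ∂_s ∂̄_q ∂̄_l Φ`. -/
def g3a (n : ℕ) (Φ : (Fin n → ℂ) → ℝ) (s q l : Fin n) : (Fin n → ℂ) → ℂ :=
  wdP n s (wdB n q (wdB n l (Phic n Φ)))

/-- `g_{a b̄ k l̄} = ∂_a ∂_k ∂̄_b ∂̄_l Φ`. -/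
def g4 (n : ℕ) (Φ : (Fin n → ℂ) → ℝ) (a b k l : Fin n) : (Fin n → ℂ) → ℂ :=
  wdP n a (wdP n k (wdB n b (wdB n l (Phic n Φ))))

/-- Christoffel symbol `Γ^s_{kp} = Σ_t g_{k p t̄} g^{t̄ s}`. -/
def GamH (n : ℕ) (Φ : (Fin n → ℂ) → ℝ) (ginv : Fin n → Fin n → (Fin n → ℂ) → ℂ)
    (s k p : Fin n) : (Fin n → ℂ) → ℂ :=
  fun z => ∑ t, g3h n Φ k p t z * ginv t s z

/-- Christoffel symbol `Γ^t̄_{l̄ q̄} = Σ_s g^{t̄ s} g_{s q̄ l̄}`. -/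
def GamB (n : ℕ) (Φ : (Fin n → ℂ) → ℝ) (ginv : Fin n → Fin n → (Fin n → ℂ) → ℂ)
    (t l q : Fin n) : (Fin n → ℂ) → ℂ :=
  fun z => ∑ s, ginv t s z * g3a n Φ s q l z

/-- Covariant derivative `ψ_{/kp} = ∂_p ψ_{/k} - Σ_s Γ^s_{pk} ψ_{/s}`. -/
def cdH2 (n : ℕ) (Φ : (Fin n → ℂ) → ℝ) (ginv : Fin n → Fin n → (Fin n → ℂ) → ℂ)
    (ψ : (Fin n → ℂ) → ℂ) (k p : Fin n) : (Fin n → ℂ) → ℂ :=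
  fun z => wdP n p (wdP n k ψ) z - ∑ s, GamH n Φ ginv s p k z * wdP n s ψ z

/-- Covariant derivative `ψ_{/kps} = ∂_s ψ_{/kp} - Σ_a Γ^a_{sk} ψ_{/ap} - Σ_a Γ^a_{sp} ψ_{/ka}`. -/
def cdH3 (n : ℕ) (Φ : (Fin n → ℂ) → ℝ) (ginv : Fin n → Fin n → (Fin n → ℂ) → ℂ)
    (ψ : (Fin n → ℂ) → ℂ) (k p s : Fin n) : (Fin n → ℂ) → ℂ :=
  fun z => wdP n s (cdH2 n Φ ginv ψ k p) z
    - ∑ a, GamH n Φ ginv a s k z * cdH2 n Φ ginv ψ a p z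
    - ∑ a, GamH n Φ ginv a s p z * cdH2 n Φ ginv ψ k a z

/-- Covariant derivative `φ_{/l̄q̄} = ∂̄_q φ_{/l̄} - Σ_t Γ^t̄_{q̄l̄} φ_{/t̄}`. -/
def cdB2 (n : ℕ) (Φ : (Fin n → ℂ) → ℝ) (ginv : Fin n → Fin n → (Fin n → ℂ) → ℂ)
    (φ : (Fin n → ℂ) → ℂ) (l q : Fin n) : (Fin n → ℂ) → ℂ :=
  fun z => wdB n q (wdB n l φ) z - ∑ t, GamB n Φ ginv t q l z * wdB n t φ z

/-- Covariant derivative `φ_{/l̄q̄t̄} = ∂̄_t φ_{/l̄q̄} - Σ_a Γ^ā_{t̄l̄} φ_{/āq̄} - Σ_a Γ^ā_{t̄q̄} φ_{/l̄ā}`. -/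
def cdB3 (n : ℕ) (Φ : (Fin n → ℂ) → ℝ) (ginv : Fin n → Fin n → (Fin n → ℂ) → ℂ)
    (φ : (Fin n → ℂ) → ℂ) (l q t : Fin n) : (Fin n → ℂ) → ℂ :=
  fun z => wdB n t (cdB2 n Φ ginv φ l q) z
    - ∑ a, GamB n Φ ginv a t l z * cdB2 n Φ ginv φ a q z
    - ∑ a, GamB n Φ ginv a t q z * cdB2 n Φ ginv φ l a z

/-- The curvature `R^{q̄p}_{k l̄} = ∂_k ∂̄_l g^{q̄p} - Σ_{m,n} (∂̄_l g^{q̄m})(∂_k g^{n̄p}) g_{m n̄}`. -/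
def Rcur (n : ℕ) (Φ : (Fin n → ℂ) → ℝ) (ginv : Fin n → Fin n → (Fin n → ℂ) → ℂ)
    (q p k l : Fin n) : (Fin n → ℂ) → ℂ :=
  fun z => wdP n k (wdB n l (ginv q p)) z
    - ∑ m, ∑ m', wdB n l (ginv q m) z * wdP n k (ginv m' p) z * gdn n Φ m m' z

/-- `R^{l̄ k q̄ p} = Σ_{a,b} g^{l̄ a} g^{b̄ k} R^{q̄p}_{a b̄}`. -/
def Rup4 (n : ℕ) (Φ : (Fin n → ℂ) → ℝ) (ginv : Fin n → Fin n → (Fin n → ℂ) → ℂ)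
    (l k q p : Fin n) : (Fin n → ℂ) → ℂ :=
  fun z => ∑ a, ∑ b, ginv l a z * ginv b k z * Rcur n Φ ginv q p a b z

/-- `C₁(φ,ψ) = Σ g^{l̄k} (∂̄_l φ)(∂_k ψ)`. -/
def C1op (n : ℕ) (ginv : Fin n → Fin n → (Fin n → ℂ) → ℂ)
    (φ ψ : (Fin n → ℂ) → ℂ) : (Fin n → ℂ) → ℂ :=
  fun z => ∑ l, ∑ k, ginv l k z * wdB n l φ z * wdP n k ψ z

/-- `C₂(φ,ψ) = (1/2) Σ g^{l̄k} g^{q̄p} φ_{/l̄q̄} ψ_{/kp}`. -/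
def C2op (n : ℕ) (Φ : (Fin n → ℂ) → ℝ) (ginv : Fin n → Fin n → (Fin n → ℂ) → ℂ)
    (φ ψ : (Fin n → ℂ) → ℂ) : (Fin n → ℂ) → ℂ :=
  fun z => (1 / 2 : ℂ) * ∑ l, ∑ k, ∑ q, ∑ p,
    ginv l k z * ginv q p z * cdB2 n Φ ginv φ l q z * cdH2 n Φ ginv ψ k p z

/-- `C̃₃(φ,ψ) = (1/6) Σ g^{l̄k} g^{q̄p} g^{t̄s} φ_{/l̄q̄t̄} ψ_{/kps}
  + (1/4) Σ R^{l̄kq̄p} φ_{/l̄q̄} ψ_{/kp}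
  + (1/12) Σ g^{n̄m} R^{l̄p}_{mq̄} R^{q̄k}_{pn̄} φ_{/l̄} ψ_{/k}`. -/
def C3top (n : ℕ) (Φ : (Fin n → ℂ) → ℝ) (ginv : Fin n → Fin n → (Fin n → ℂ) → ℂ)
    (φ ψ : (Fin n → ℂ) → ℂ) : (Fin n → ℂ) → ℂ :=
  fun z =>
    (1 / 6 : ℂ) * (∑ l, ∑ k, ∑ q, ∑ p, ∑ t, ∑ s,
        ginv l k z * ginv q p z * ginv t s z *
          cdB3 n Φ ginv φ l q t z * cdH3 n Φ ginv ψ k p s z)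
    + (1 / 4 : ℂ) * (∑ l, ∑ k, ∑ q, ∑ p,
        Rup4 n Φ ginv l k q p z * cdB2 n Φ ginv φ l q z * cdH2 n Φ ginv ψ k p z)
    + (1 / 12 : ℂ) * (∑ l, ∑ k, (∑ m, ∑ m', ∑ p, ∑ q,
        ginv m' m z * Rcur n Φ ginv l p m q z * Rcur n Φ ginv q k p m' z) *
          wdB n l φ z * wdP n k ψ z)

/-- `P(φ,ψ) = Σ g^{l̄k} g^{q̄p} g^{t̄s} φ_{/l̄q̄t̄} ψ_{/kps}`. -/
def Pop (n : ℕ) (Φ : (Fin n → ℂ) → ℝ) (ginv : Fin n → Fin n → (Fin n → ℂ) → ℂ)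
    (φ ψ : (Fin n → ℂ) → ℂ) : (Fin n → ℂ) → ℂ :=
  fun z => ∑ l, ∑ k, ∑ q, ∑ p, ∑ t, ∑ s,
    ginv l k z * ginv q p z * ginv t s z * cdB3 n Φ ginv φ l q t z * cdH3 n Φ ginv ψ k p s z

/-- `Q(φ,ψ) = - Σ R^{l̄kq̄p} φ_{/l̄q̄} ψ_{/kp}`. -/
def Qop (n : ℕ) (Φ : (Fin n → ℂ) → ℝ) (ginv : Fin n → Fin n → (Fin n → ℂ) → ℂ)
    (φ ψ : (Fin n → ℂ) → ℂ) : (Fin n → ℂ) → ℂ :=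
  fun z => -∑ l, ∑ k, ∑ q, ∑ p,
    Rup4 n Φ ginv l k q p z * cdB2 n Φ ginv φ l q z * cdH2 n Φ ginv ψ k p z

/-- `R(φ,ψ) = Σ g^{n̄m} R^{l̄p}_{mq̄} R^{q̄k}_{pn̄} φ_{/l̄} ψ_{/k}`. -/
def Rop (n : ℕ) (Φ : (Fin n → ℂ) → ℝ) (ginv : Fin n → Fin n → (Fin n → ℂ) → ℂ)
    (φ ψ : (Fin n → ℂ) → ℂ) : (Fin n → ℂ) → ℂ :=
  fun z => ∑ l, ∑ k,
    (∑ m, ∑ m', ∑ p, ∑ q, ginv m' m z * Rcur n Φ ginv l p m q z * Rcur n Φ ginv q k p m' z) *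
      wdB n l φ z * wdP n k ψ z

/-- `S(φ,ψ) = Σ g_{mn̄} (∂̄_q g^{l̄s})(∂_s g^{n̄p})(∂̄_t g^{q̄m})(∂_p g^{t̄k}) (∂̄_l φ)(∂_k ψ)`. -/
def Sop (n : ℕ) (Φ : (Fin n → ℂ) → ℝ) (ginv : Fin n → Fin n → (Fin n → ℂ) → ℂ)
    (φ ψ : (Fin n → ℂ) → ℂ) : (Fin n → ℂ) → ℂ :=
  fun z => ∑ l, ∑ k,
    (∑ m, ∑ m', ∑ p, ∑ q, ∑ s, ∑ t,
        gdn n Φ m m' z * wdB n q (ginv l s) z * wdP n s (ginv m' p) z *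
          wdB n t (ginv q m) z * wdP n p (ginv t k) z) *
      wdB n l φ z * wdP n k ψ z

/-- A function is regular if it lies in the ℂ-subalgebra of functions generated by all
iterated Wirtinger derivatives `∂_A ∂̄_B g^{q̄p}` of the entries of the inverse metric. -/
def Regular (n : ℕ) (ginv : Fin n → Fin n → (Fin n → ℂ) → ℂ)
    (f : (Fin n → ℂ) → ℂ) : Prop :=
  f ∈ Algebra.adjoin ℂ
    {h : (Fin n → ℂ) → ℂ | ∃ (A B : List (Fin n)) (q p : Fin n),
      h = A.foldr (fun k g => wdP n k g) (B.foldr (fun l g => wdB n l g) (ginv q p))}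

/-- A bidifferential operator is regular on `U` if it can be written with finitely many
terms of the form `b^{l̄₁…l̄_β k₁…k_α} (∂̄_{l₁}…∂̄_{l_β} φ)(∂_{k₁}…∂_{k_α} ψ)`
with all coefficients `b` regular. -/
def RegularOp (n : ℕ) (U : Set (Fin n → ℂ)) (ginv : Fin n → Fin n → (Fin n → ℂ) → ℂ)
    (T : ((Fin n → ℂ) → ℂ) → ((Fin n → ℂ) → ℂ) → (Fin n → ℂ) → ℂ) : Prop :=
  ∃ (N : ℕ) (b : Fin N → (Fin n → ℂ) → ℂ) (A B : Fin N → List (Fin n)),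
    (∀ j, Regular n ginv (b j)) ∧
    ∀ φ ψ : (Fin n → ℂ) → ℂ,
      ContDiffOn ℝ (⊤ : ℕ∞) φ U → ContDiffOn ℝ (⊤ : ℕ∞) ψ U →
      ∀ z ∈ U,
        T φ ψ z = ∑ j, b j z * ((B j).foldr (fun l g => wdB n l g) φ) z *
          ((A j).foldr (fun k g => wdP n k g) ψ) z


/-! ### Generic Wirtinger derivatives -/

/-- A uniform version of both Wirtinger derivatives (`σ = -i` or `σ = i`). -/
def wd (n : ℕ) (σ : ℂ) (k : Fin n) (f : (Fin n → ℂ) → ℂ) : (Fin n → ℂ) → ℂ :=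
  fun z => (1 / 2 : ℂ) *
    (fderiv ℝ f z (ebasis n k) + σ * fderiv ℝ f z (Complex.I • ebasis n k))

lemma wdP_eq (n : ℕ) (k : Fin n) (f : (Fin n → ℂ) → ℂ) : wdP n k f = wd n (-Complex.I) k f := by
  funext z; simp only [wdP, wd]; ring

lemma wdB_eq (n : ℕ) (k : Fin n) (f : (Fin n → ℂ) → ℂ) : wdB n k f = wd n Complex.I k f := rfl

/-- Smoothness on `U`. -/
def Sm {n : ℕ} (U : Set (Fin n → ℂ)) (f : (Fin n → ℂ) → ℂ) : Prop :=
  ContDiffOn ℝ (⊤ : ℕ∞) f U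

lemma Sm.mul {n : ℕ} {U : Set (Fin n → ℂ)} {f g : (Fin n → ℂ) → ℂ} (hf : Sm U f) (hg : Sm U g) :
    Sm U (fun z => f z * g z) := ContDiffOn.mul hf hg

lemma Sm.add {n : ℕ} {U : Set (Fin n → ℂ)} {f g : (Fin n → ℂ) → ℂ} (hf : Sm U f) (hg : Sm U g) :
    Sm U (fun z => f z + g z) := ContDiffOn.add hf hg

lemma Sm.sub {n : ℕ} {U : Set (Fin n → ℂ)} {f g : (Fin n → ℂ) → ℂ} (hf : Sm U f) (hg : Sm U g) :
    Sm U (fun z => f z - g z) := ContDiffOn.sub hf hg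

lemma Sm.sum {n m : ℕ} {U : Set (Fin n → ℂ)} {f : Fin m → (Fin n → ℂ) → ℂ}
    (hf : ∀ i, Sm U (f i)) : Sm U (fun z => ∑ i, f i z) :=
  ContDiffOn.sum fun i _ => hf i

lemma Sm.diff {n : ℕ} {U : Set (Fin n → ℂ)} (hU : IsOpen U) {f : (Fin n → ℂ) → ℂ} (hf : Sm U f)
    {z : Fin n → ℂ} (hz : z ∈ U) : DifferentiableAt ℝ f z :=
  (ContDiffOn.contDiffAt hf (hU.mem_nhds hz)).differentiableAt (by simp)

lemma Sm.fd {n : ℕ} {U : Set (Fin n → ℂ)} (hU : IsOpen U) {f : (Fin n → ℂ) → ℂ} (hf : Sm U f) :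
    ContDiffOn ℝ (⊤ : ℕ∞) (fderiv ℝ f) U :=
  ContDiffOn.fderiv_of_isOpen hf hU (by exact_mod_cast le_top)

lemma Sm.wd {n : ℕ} {U : Set (Fin n → ℂ)} (hU : IsOpen U) {f : (Fin n → ℂ) → ℂ} (hf : Sm U f)
    (σ : ℂ) (k : Fin n) : Sm U (wd n σ k f) := by
  have h := hf.fd hU
  unfold Sm _root_.wd
  exact contDiffOn_const.mul ((h.clm_apply contDiffOn_const).add
    (contDiffOn_const.mul (h.clm_apply contDiffOn_const)))

lemma wd_congr {n : ℕ} {U : Set (Fin n → ℂ)} (hU : IsOpen U) {f g : (Fin n → ℂ) → ℂ}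
    (h : ∀ z ∈ U, f z = g z) (σ : ℂ) (k : Fin n) : ∀ z ∈ U, wd n σ k f z = wd n σ k g z := by
  intro z hz
  have : f =ᶠ[nhds z] g := Filter.eventually_of_mem (hU.mem_nhds hz) h
  simp only [wd, this.fderiv_eq]

lemma wd_add {n : ℕ} {σ : ℂ} {k : Fin n} {f g : (Fin n → ℂ) → ℂ} {z : Fin n → ℂ}
    (hf : DifferentiableAt ℝ f z) (hg : DifferentiableAt ℝ g z) :
    wd n σ k (fun z => f z + g z) z = wd n σ k f z + wd n σ k g z := by
  simp only [wd, fderiv_fun_add hf hg, add_apply]; ring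

lemma wd_mul {n : ℕ} {σ : ℂ} {k : Fin n} {f g : (Fin n → ℂ) → ℂ} {z : Fin n → ℂ}
    (hf : DifferentiableAt ℝ f z) (hg : DifferentiableAt ℝ g z) :
    wd n σ k (fun z => f z * g z) z = wd n σ k f z * g z + f z * wd n σ k g z := by
  simp only [wd, fderiv_fun_mul hf hg, add_apply,
    smul_apply, smul_eq_mul]; ring

lemma wd_sum {n m : ℕ} {σ : ℂ} {k : Fin n} {f : Fin m → (Fin n → ℂ) → ℂ} {z : Fin n → ℂ}
    (hf : ∀ i, DifferentiableAt ℝ (f i) z) :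
    wd n σ k (fun z => ∑ i, f i z) z = ∑ i, wd n σ k (f i) z := by
  simp only [wd, fderiv_fun_sum (fun i _ => hf i), sum_apply, Finset.mul_sum,
    ← Finset.sum_add_distrib]

lemma wd_const {n : ℕ} {σ : ℂ} {k : Fin n} {c : ℂ} {z : Fin n → ℂ} :
    wd n σ k (fun _ => c) z = 0 := by
  simp [wd]

lemma fderiv_wd {n : ℕ} {U : Set (Fin n → ℂ)} (hU : IsOpen U) {f : (Fin n → ℂ) → ℂ} (hf : Sm U f)
    (σ : ℂ) (k : Fin n) {z : Fin n → ℂ} (hz : z ∈ U) (v : Fin n → ℂ) :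
    fderiv ℝ (wd n σ k f) z v = (1 / 2 : ℂ) * (fderiv ℝ (fderiv ℝ f) z v (ebasis n k)
      + σ * fderiv ℝ (fderiv ℝ f) z v (Complex.I • ebasis n k)) := by
  have h : DifferentiableAt ℝ (fderiv ℝ f) z :=
    ((hf.fd hU).contDiffAt (hU.mem_nhds hz)).differentiableAt (by simp)
  have h1 : ∀ w : Fin n → ℂ, HasFDerivAt (fun y => fderiv ℝ f y w)
      ((ContinuousLinearMap.apply ℝ ℂ w).comp (fderiv ℝ (fderiv ℝ f) z)) z := fun w =>
    (ContinuousLinearMap.apply ℝ ℂ w).hasFDerivAt.comp z h.hasFDerivAt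
  have h2 := (((h1 (ebasis n k)).add ((h1 (Complex.I • ebasis n k)).const_mul σ)).const_mul
    (1 / 2 : ℂ))
  have h3 : fderiv ℝ (wd n σ k f) z = _ := h2.fderiv
  rw [h3]
  simp
  ring

lemma wd_comm {n : ℕ} {U : Set (Fin n → ℂ)} (hU : IsOpen U) {f : (Fin n → ℂ) → ℂ} (hf : Sm U f)
    (σ τ : ℂ) (k l : Fin n) : ∀ z ∈ U, wd n σ k (wd n τ l f) z = wd n τ l (wd n σ k f) z := by
  intro z hz
  have hs : IsSymmSndFDerivAt ℝ f z :=
    (ContDiffOn.contDiffAt hf (hU.mem_nhds hz)).isSymmSndFDerivAt (by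
      rw [minSmoothness_of_isRCLikeNormedField]
      exact WithTop.coe_le_coe.mpr (le_top : (2 : ℕ∞) ≤ ⊤))
  rw [wd, fderiv_wd hU hf τ l hz, fderiv_wd hU hf τ l hz, wd, fderiv_wd hU hf σ k hz,
    fderiv_wd hU hf σ k hz, hs (ebasis n k) (ebasis n l), hs (ebasis n k) (Complex.I • ebasis n l),
    hs (Complex.I • ebasis n k) (ebasis n l),
    hs (Complex.I • ebasis n k) (Complex.I • ebasis n l)]
  ring

/-! ### Generic metric facts, used for both the holomorphic and the antiholomorphic side -/

/-- Package: `M` is a matrix of smooth functions with inverse `N`, whose derivatives `wd σ` have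
the Kähler symmetry. -/
structure Met (n : ℕ) (U : Set (Fin n → ℂ)) (σ : ℂ)
    (M N : Fin n → Fin n → (Fin n → ℂ) → ℂ) : Prop where
  op : IsOpen U
  smM : ∀ a b, Sm U (M a b)
  smN : ∀ a b, Sm U (N a b)
  inv1 : ∀ z ∈ U, ∀ l q : Fin n, (∑ k, N l k z * M k q z) = if l = q then 1 else 0
  inv2 : ∀ z ∈ U, ∀ p k : Fin n, (∑ l, M p l z * N l k z) = if p = k then 1 else 0
  sym : ∀ k p t, ∀ z ∈ U, wd n σ k (M p t) z = wd n σ p (M k t) z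

/-- Generic Christoffel symbol. -/
def Gam (n : ℕ) (σ : ℂ) (M N : Fin n → Fin n → (Fin n → ℂ) → ℂ) (s k p : Fin n) :
    (Fin n → ℂ) → ℂ :=
  fun z => ∑ t, wd n σ k (M p t) z * N t s z

/-- Generic second covariant derivative. -/
def cd2 (n : ℕ) (σ : ℂ) (M N : Fin n → Fin n → (Fin n → ℂ) → ℂ)
    (ψ : (Fin n → ℂ) → ℂ) (k p : Fin n) : (Fin n → ℂ) → ℂ :=
  fun z => wd n σ p (wd n σ k ψ) z - ∑ s, Gam n σ M N s p k z * wd n σ s ψ z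

/-- Generic third covariant derivative. -/
def cd3 (n : ℕ) (σ : ℂ) (M N : Fin n → Fin n → (Fin n → ℂ) → ℂ)
    (ψ : (Fin n → ℂ) → ℂ) (k p s : Fin n) : (Fin n → ℂ) → ℂ :=
  fun z => wd n σ s (cd2 n σ M N ψ k p) z
    - ∑ a, Gam n σ M N a s k z * cd2 n σ M N ψ a p z
    - ∑ a, Gam n σ M N a s p z * cd2 n σ M N ψ k a z

/-- `∂_p (g^{l k} ∂_k ψ)`, expanded. -/
def dX (n : ℕ) (σ : ℂ) (N : Fin n → Fin n → (Fin n → ℂ) → ℂ) (l p : Fin n)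
    (ψ : (Fin n → ℂ) → ℂ) : (Fin n → ℂ) → ℂ :=
  fun z => ∑ k, (wd n σ p (N l k) z * wd n σ k ψ z + N l k z * wd n σ p (wd n σ k ψ) z)

/-- `∂_s ∂_p (g^{l k} ∂_k ψ)`, expanded. -/
def ddX (n : ℕ) (σ : ℂ) (N : Fin n → Fin n → (Fin n → ℂ) → ℂ) (l s p : Fin n)
    (ψ : (Fin n → ℂ) → ℂ) : (Fin n → ℂ) → ℂ :=
  fun z => ∑ k, ((wd n σ s (wd n σ p (N l k)) z * wd n σ k ψ z
      + wd n σ p (N l k) z * wd n σ s (wd n σ k ψ) z)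
    + (wd n σ s (N l k) z * wd n σ p (wd n σ k ψ) z
      + N l k z * wd n σ s (wd n σ p (wd n σ k ψ)) z))

namespace Met

variable {n : ℕ} {U : Set (Fin n → ℂ)} {σ : ℂ} {M N : Fin n → Fin n → (Fin n → ℂ) → ℂ}

lemma contr1 (h : Met n U σ M N) {z : Fin n → ℂ} (hz : z ∈ U) (q : Fin n) (f : Fin n → ℂ) :
    ∑ p, N q p z * ∑ t, M p t z * f t = f q := by
  simp only [Finset.mul_sum]
  rw [Finset.sum_comm]
  simp only [← mul_assoc, ← Finset.sum_mul, h.inv1 z hz]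
  simp

lemma contr2 (h : Met n U σ M N) {z : Fin n → ℂ} (hz : z ∈ U) (q : Fin n) (f : Fin n → ℂ) :
    ∑ p, M q p z * ∑ t, N p t z * f t = f q := by
  simp only [Finset.mul_sum]
  rw [Finset.sum_comm]
  simp only [← mul_assoc, ← Finset.sum_mul, h.inv2 z hz]
  simp

lemma Gam_eq (h : Met n U σ M N) {z : Fin n → ℂ} (hz : z ∈ U) (s k p : Fin n) :
    Gam n σ M N s k p z = - ∑ t, M p t z * wd n σ k (N t s) z := by
  have h1 := wd_congr h.op (fun z hz => h.inv2 z hz p s) σ k z hz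
  rw [wd_const, wd_sum (fun i => ((h.smM p i).mul (h.smN i s)).diff h.op hz)] at h1
  rw [eq_neg_iff_add_eq_zero, Gam, ← Finset.sum_add_distrib, ← h1]
  refine Finset.sum_congr rfl fun t _ => ?_
  rw [wd_mul ((h.smM p t).diff h.op hz) ((h.smN t s).diff h.op hz)]

lemma Gam_sym (h : Met n U σ M N) {z : Fin n → ℂ} (hz : z ∈ U) (s k p : Fin n) :
    Gam n σ M N s k p z = Gam n σ M N s p k z := by
  unfold Gam
  exact Finset.sum_congr rfl fun t _ => by rw [h.sym k p t z hz]

lemma N_Gam (h : Met n U σ M N) {z : Fin n → ℂ} (hz : z ∈ U) (q s k : Fin n) :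
    ∑ p, N q p z * Gam n σ M N s k p z = - wd n σ k (N q s) z := by
  simp only [h.Gam_eq hz, mul_neg, Finset.sum_neg_distrib]
  rw [h.contr1 hz q (fun t => wd n σ k (N t s) z)]

lemma Msym (h : Met n U σ M N) {z : Fin n → ℂ} (hz : z ∈ U) (s k p : Fin n) :
    ∑ t, M p t z * wd n σ k (N t s) z = ∑ t, M k t z * wd n σ p (N t s) z := by
  have := h.Gam_sym hz s k p
  rw [h.Gam_eq hz, h.Gam_eq hz] at this
  exact neg_injective this

lemma K (h : Met n U σ M N) {z : Fin n → ℂ} (hz : z ∈ U) (l p m : Fin n) :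
    ∑ a, N l a z * ∑ m', M m m' z * wd n σ a (N m' p) z = wd n σ m (N l p) z := by
  simp only [h.Msym hz p _ m]
  rw [h.contr1 hz l (fun t => wd n σ m (N t p) z)]

lemma smGam (h : Met n U σ M N) (s k p : Fin n) : Sm U (Gam n σ M N s k p) :=
  Sm.sum fun t => ((h.smM p t).wd h.op σ k).mul (h.smN t s)

lemma smcd2 (h : Met n U σ M N) {ψ : (Fin n → ℂ) → ℂ} (hψ : Sm U ψ) (k p : Fin n) :
    Sm U (cd2 n σ M N ψ k p) :=
  ((hψ.wd h.op σ k).wd h.op σ p).sub (Sm.sum fun s => (h.smGam s p k).mul (hψ.wd h.op σ s))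

lemma cd2_sym (h : Met n U σ M N) {ψ : (Fin n → ℂ) → ℂ} (hψ : Sm U ψ) (k p : Fin n) :
    ∀ z ∈ U, cd2 n σ M N ψ k p z = cd2 n σ M N ψ p k z := by
  intro z hz
  unfold cd2
  rw [wd_comm h.op hψ σ σ p k z hz]
  simp only [h.Gam_sym hz _ p k]

lemma N_cd2 (h : Met n U σ M N) {ψ : (Fin n → ℂ) → ℂ} (l p : Fin n) :
    ∀ z ∈ U, ∑ k, N l k z * cd2 n σ M N ψ k p z = dX n σ N l p ψ z := by
  intro z hz
  unfold cd2 dX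
  simp only [mul_sub, Finset.sum_sub_distrib, Finset.sum_add_distrib]
  have : ∑ k, N l k z * ∑ s, Gam n σ M N s p k z * wd n σ s ψ z
      = - ∑ k, wd n σ p (N l k) z * wd n σ k ψ z := by
    simp only [Finset.mul_sum]
    rw [Finset.sum_comm]
    simp only [← mul_assoc, ← Finset.sum_mul, h.N_Gam hz, neg_mul, Finset.sum_neg_distrib]
  rw [this]
  ring

lemma wd_dX (h : Met n U σ M N) {ψ : (Fin n → ℂ) → ℂ} (hψ : Sm U ψ) (l p s : Fin n) :
    ∀ z ∈ U, wd n σ s (dX n σ N l p ψ) z = ddX n σ N l s p ψ z := by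
  intro z hz
  have h1 := fun k => (h.smN l k).wd h.op σ p
  have h2 := fun k => hψ.wd h.op σ k
  have h3 := fun k => (hψ.wd h.op σ k).wd h.op σ p
  unfold dX ddX
  rw [wd_sum (fun k => (((h1 k).mul (h2 k)).add ((h.smN l k).mul (h3 k))).diff h.op hz)]
  refine Finset.sum_congr rfl fun k _ => ?_
  rw [wd_add (((h1 k).mul (h2 k)).diff h.op hz) (((h.smN l k).mul (h3 k)).diff h.op hz),
    wd_mul ((h1 k).diff h.op hz) ((h2 k).diff h.op hz),
    wd_mul ((h.smN l k).diff h.op hz) ((h3 k).diff h.op hz)]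

lemma N_cd3 (h : Met n U σ M N) {ψ : (Fin n → ℂ) → ℂ} (hψ : Sm U ψ) (l p s : Fin n) :
    ∀ z ∈ U, ∑ k, N l k z * cd3 n σ M N ψ k p s z
      = ddX n σ N l s p ψ z - ∑ a, Gam n σ M N a s p z * dX n σ N l a ψ z := by
  intro z hz
  have h1 := wd_congr h.op (h.N_cd2 (ψ := ψ) l p) σ s z hz
  rw [h.wd_dX hψ l p s z hz,
    wd_sum (fun k => ((h.smN l k).mul (h.smcd2 hψ k p)).diff h.op hz)] at h1
  simp only [fun k => wd_mul (σ := σ) (k := s) ((h.smN l k).diff h.op hz)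
    ((h.smcd2 hψ k p).diff h.op hz)] at h1
  rw [Finset.sum_add_distrib] at h1
  unfold cd3
  simp only [mul_sub, Finset.sum_sub_distrib]
  have h2 : ∑ k, N l k z * ∑ a, Gam n σ M N a s k z * cd2 n σ M N ψ a p z
      = - ∑ k, wd n σ s (N l k) z * cd2 n σ M N ψ k p z := by
    simp only [Finset.mul_sum]
    rw [Finset.sum_comm]
    simp only [← mul_assoc, ← Finset.sum_mul, h.N_Gam hz, neg_mul, Finset.sum_neg_distrib]
  have h3 : ∑ k, N l k z * ∑ a, Gam n σ M N a s p z * cd2 n σ M N ψ k a z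
      = ∑ a, Gam n σ M N a s p z * dX n σ N l a ψ z := by
    simp only [← h.N_cd2 _ _ z hz, Finset.mul_sum]
    rw [Finset.sum_comm]
    exact Finset.sum_congr rfl fun _ _ => Finset.sum_congr rfl fun _ _ => by ring
  rw [h2, h3, ← h1]
  ring

lemma NN_cd3 (h : Met n U σ M N) {ψ : (Fin n → ℂ) → ℂ} (hψ : Sm U ψ) (l q s : Fin n) :
    ∀ z ∈ U, ∑ p, N q p z * ∑ k, N l k z * cd3 n σ M N ψ k p s z
      = ∑ p, (N q p z * ddX n σ N l s p ψ z + wd n σ s (N q p) z * dX n σ N l p ψ z) := by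
  intro z hz
  simp only [h.N_cd3 hψ _ _ _ z hz, mul_sub, Finset.sum_sub_distrib, Finset.sum_add_distrib]
  have : ∑ p, N q p z * ∑ a, Gam n σ M N a s p z * dX n σ N l a ψ z
      = - ∑ a, wd n σ s (N q a) z * dX n σ N l a ψ z := by
    simp only [Finset.mul_sum]
    rw [Finset.sum_comm]
    simp only [← mul_assoc, ← Finset.sum_mul, h.N_Gam hz, neg_mul, Finset.sum_neg_distrib]
  rw [this]
  ring

lemma cd3_sym12 (h : Met n U σ M N) {ψ : (Fin n → ℂ) → ℂ} (hψ : Sm U ψ) (k p s : Fin n) :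
    ∀ z ∈ U, cd3 n σ M N ψ k p s z = cd3 n σ M N ψ p k s z := by
  intro z hz
  unfold cd3
  rw [wd_congr h.op (h.cd2_sym hψ k p) σ s z hz]
  simp only [fun a => h.cd2_sym hψ k a z hz, fun a => h.cd2_sym hψ a p z hz]
  ring

lemma ddX_sym (h : Met n U σ M N) {ψ : (Fin n → ℂ) → ℂ} (hψ : Sm U ψ) (l s p : Fin n) :
    ∀ z ∈ U, ddX n σ N l s p ψ z = ddX n σ N l p s ψ z := by
  intro z hz
  unfold ddX
  refine Finset.sum_congr rfl fun k _ => ?_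
  rw [wd_comm h.op (h.smN l k) σ σ s p z hz, wd_comm h.op (hψ.wd h.op σ k) σ σ s p z hz]
  ring

lemma cd3_sym23 (h : Met n U σ M N) {ψ : (Fin n → ℂ) → ℂ} (hψ : Sm U ψ) (k p s : Fin n) :
    ∀ z ∈ U, cd3 n σ M N ψ k p s z = cd3 n σ M N ψ k s p z := by
  intro z hz
  rw [← h.contr2 hz k (fun k => cd3 n σ M N ψ k p s z),
    ← h.contr2 hz k (fun k => cd3 n σ M N ψ k s p z)]
  simp only [h.N_cd3 hψ _ _ _ z hz]
  simp only [h.ddX_sym hψ _ s p z hz, h.Gam_sym hz _ s p]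

end Met

/-! ### Pointwise index algebra -/

/-! The lemmas `pullj` bring the `j`-th summation index to the front. -/

lemma pull1 {n : ℕ} {f r : Fin n → ℂ} (h : ∀ a, f a = r a) : ∑ a, f a = ∑ a, r a :=
  Finset.sum_congr rfl fun a _ => h a

lemma pull2 {n : ℕ} {f : Fin n → Fin n → ℂ} {r : Fin n → ℂ} (h : ∀ b, ∑ a, f a b = r b) :
    ∑ a, ∑ b, f a b = ∑ b, r b := by
  rw [Finset.sum_comm]; exact pull1 h

lemma pull3 {n : ℕ} {f : Fin n → Fin n → Fin n → ℂ} {r : Fin n → ℂ}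
    (h : ∀ c, ∑ a, ∑ b, f a b c = r c) :
    ∑ a, ∑ b, ∑ c, f a b c = ∑ c, r c := by
  rw [pull1 (fun a => Finset.sum_comm)]; exact pull2 h

lemma pull4 {n : ℕ} {f : Fin n → Fin n → Fin n → Fin n → ℂ} {r : Fin n → ℂ}
    (h : ∀ d, ∑ a, ∑ b, ∑ c, f a b c d = r d) :
    ∑ a, ∑ b, ∑ c, ∑ d, f a b c d = ∑ d, r d := by
  rw [pull1 (fun a => pull3 (fun d => rfl))]; exact pull2 h

lemma pull5 {n : ℕ} {f : Fin n → Fin n → Fin n → Fin n → Fin n → ℂ} {r : Fin n → ℂ}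
    (h : ∀ e, ∑ a, ∑ b, ∑ c, ∑ d, f a b c d e = r e) :
    ∑ a, ∑ b, ∑ c, ∑ d, ∑ e, f a b c d e = ∑ e, r e := by
  rw [pull1 (fun a => pull4 (fun d => rfl))]; exact pull2 h

lemma pull6 {n : ℕ} {f : Fin n → Fin n → Fin n → Fin n → Fin n → Fin n → ℂ} {r : Fin n → ℂ}
    (h : ∀ x, ∑ a, ∑ b, ∑ c, ∑ d, ∑ e, f a b c d e x = r x) :
    ∑ a, ∑ b, ∑ c, ∑ d, ∑ e, ∑ x, f a b c d e x = ∑ x, r x := by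
  rw [pull1 (fun a => pull5 (fun d => rfl))]; exact pull2 h

/-- The coefficient of `S` at a point. -/
def Sco {n : ℕ} (g : Fin n → Fin n → ℂ) (Gp Gb : Fin n → Fin n → Fin n → ℂ) (l k : Fin n) : ℂ :=
  ∑ m, ∑ m', ∑ p, ∑ q, ∑ s, ∑ t,
    g m m' * Gb q l s * Gp s m' p * Gb t q m * Gp p t k

lemma R_alg {n : ℕ} (G g : Fin n → Fin n → ℂ) (Gp Gb : Fin n → Fin n → Fin n → ℂ)
    (A : Fin n → Fin n → Fin n → Fin n → ℂ)
    (Kp : ∀ l p m, ∑ a, G l a * ∑ m', g m m' * Gp a m' p = Gp m l p)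
    (Kb : ∀ l p m, ∑ a, G a l * ∑ m', g m' m * Gb a p m' = Gb m p l)
    (Sb : ∀ s k p, ∑ t, g t p * Gb k s t = ∑ t, g t k * Gb p s t) (l k : Fin n) :
    (∑ m, ∑ m', ∑ p, ∑ q, G m' m * (A m q l p - ∑ a, ∑ b, Gb q l a * Gp m b p * g a b) *
      (A p m' q k - ∑ a, ∑ b, Gb m' q a * Gp p b k * g a b)) - Sco g Gp Gb l k =
    ((∑ m, ∑ m', ∑ p, ∑ q, G m' m * A m q l p * A p m' q k)
      - ∑ m, ∑ p, ∑ q, ∑ t, A m q l p * Gb t q m * Gp p t k)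
      - ∑ a, ∑ m', ∑ p, ∑ q, Gb q l a * Gp a m' p * A p m' q k := by
  have e1 : ∑ m, ∑ m', ∑ p, ∑ q, G m' m * (A m q l p - ∑ a, ∑ b, Gb q l a * Gp m b p * g a b) *
      (A p m' q k - ∑ a, ∑ b, Gb m' q a * Gp p b k * g a b)
      = (∑ m, ∑ m', ∑ p, ∑ q, G m' m * A m q l p * A p m' q k)
      - (∑ m, ∑ m', ∑ p, ∑ q, G m' m * A m q l p * ∑ a, ∑ b, Gb m' q a * Gp p b k * g a b)
      - (∑ m, ∑ m', ∑ p, ∑ q, G m' m * (∑ a, ∑ b, Gb q l a * Gp m b p * g a b) * A p m' q k)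
      + (∑ m, ∑ m', ∑ p, ∑ q, G m' m * (∑ a, ∑ b, Gb q l a * Gp m b p * g a b) *
          ∑ a, ∑ b, Gb m' q a * Gp p b k * g a b) := by
    simp only [← Finset.sum_add_distrib, ← Finset.sum_sub_distrib]
    exact pull1 fun m => pull1 fun m' => pull1 fun p => pull1 fun q => by ring
  have e2 : ∑ m, ∑ m', ∑ p, ∑ q, G m' m * A m q l p * ∑ a, ∑ b, Gb m' q a * Gp p b k * g a b
      = ∑ m, ∑ p, ∑ q, ∑ t, A m q l p * Gb t q m * Gp p t k := by
    trans ∑ m, ∑ p, ∑ q, ∑ t, A m q l p * (∑ a, G a m * ∑ m', g m' t * Gb a q m') * Gp p t k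
    · simp only [Finset.sum_mul, Finset.mul_sum]
      exact pull1 fun m => pull2 fun p => pull2 fun q => pull3 fun t => pull1 fun a =>
        pull1 fun m' => by ring
    · simp only [Kb]
  have e3' : ∀ m' p q, ∑ m, G m' m * (∑ a, ∑ b, Gb q l a * Gp m b p * g a b)
      = ∑ a, Gb q l a * Gp a m' p := by
    intro m' p q
    trans ∑ a, Gb q l a * ∑ m, G m' m * ∑ b, g a b * Gp m b p
    · simp only [Finset.mul_sum]
      exact pull2 fun a => pull1 fun m => pull1 fun b => by ring
    · simp only [Kp]
  have e3 : ∑ m, ∑ m', ∑ p, ∑ q, G m' m * (∑ a, ∑ b, Gb q l a * Gp m b p * g a b) * A p m' q k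
      = ∑ a, ∑ m', ∑ p, ∑ q, Gb q l a * Gp a m' p * A p m' q k := by
    trans ∑ m', ∑ p, ∑ q, (∑ m, G m' m * (∑ a, ∑ b, Gb q l a * Gp m b p * g a b)) * A p m' q k
    · exact pull2 fun m' => pull2 fun p => pull2 fun q => (Finset.sum_mul _ _ _).symm
    · simp only [e3', Finset.sum_mul]
      exact pull4 fun a => rfl
  have e4 : ∑ m, ∑ m', ∑ p, ∑ q, G m' m * (∑ a, ∑ b, Gb q l a * Gp m b p * g a b) *
          (∑ a, ∑ b, Gb m' q a * Gp p b k * g a b) = Sco g Gp Gb l k := by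
    have d : ∀ m' q p, ∑ a, ∑ b, Gb m' q a * Gp p b k * g a b
        = ∑ b, Gp p b k * ∑ a, g a m' * Gb b q a := by
      intro m' q p
      rw [Finset.sum_comm]
      refine Finset.sum_congr rfl fun b _ => ?_
      rw [← Sb, Finset.mul_sum]
      exact Finset.sum_congr rfl fun a _ => by ring
    trans ∑ m', ∑ p, ∑ q, (∑ m, G m' m * (∑ a, ∑ b, Gb q l a * Gp m b p * g a b)) *
        ∑ a, ∑ b, Gb m' q a * Gp p b k * g a b
    · exact pull2 fun m' => pull2 fun p => pull2 fun q => (Finset.sum_mul _ _ _).symm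
    · simp only [e3', d]
      simp only [Sco, Finset.sum_mul, Finset.mul_sum]
      exact pull5 fun m => pull1 fun m' => pull1 fun p => pull1 fun q => pull2 fun s =>
        pull1 fun t => by ring
  rw [e1, e2, e3, e4]
  ring

lemma Q_alg {n : ℕ} (G g : Fin n → Fin n → ℂ) (Gp Gb : Fin n → Fin n → Fin n → ℂ)
    (A : Fin n → Fin n → Fin n → Fin n → ℂ)
    (Kp : ∀ l p m, ∑ a, G l a * ∑ m', g m m' * Gp a m' p = Gp m l p)
    (Kb : ∀ l p m, ∑ a, G a l * ∑ m', g m' m * Gb a p m' = Gb m p l)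
    (x1 y1 : Fin n → ℂ) (x2 y2 cB cH dX dY : Fin n → Fin n → ℂ)
    (hdX : ∀ b p, dX b p = ∑ k, (Gp p b k * x1 k + G b k * x2 p k))
    (hdY : ∀ a q, dY a q = ∑ l, (Gb q l a * y1 l + G l a * y2 q l))
    (hB : ∀ a q, ∑ l, G l a * cB l q = dY a q)
    (hH : ∀ b p, ∑ k, G b k * cH k p = dX b p) :
    (-∑ l, ∑ k, ∑ q, ∑ p, (∑ a, ∑ b, G l a * G b k *
        (A a b q p - ∑ m, ∑ m', Gb b q m * Gp a m' p * g m m')) * cB l q * cH k p)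
      - ∑ l, ∑ k, Sco g Gp Gb l k * y1 l * x1 k =
    ((∑ q, ∑ p, ∑ a, ∑ b, -A a b q p * (dY a q * dX b p))
      + ∑ q, ∑ p, ∑ b, ∑ m, ∑ l, (Gb b q m * Gp m l p) * (y2 q l * dX b p))
      + ∑ q, ∑ p, ∑ a, ∑ m', ∑ l, ∑ k,
          (Gb m' q k * Gp a m' p * Gb q l a) * (y1 l * x2 p k) := by
  have e1 : ∑ l, ∑ k, ∑ q, ∑ p, (∑ a, ∑ b, G l a * G b k *
        (A a b q p - ∑ m, ∑ m', Gb b q m * Gp a m' p * g m m')) * cB l q * cH k p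
      = ∑ q, ∑ p, ∑ a, ∑ b, (A a b q p - ∑ m, ∑ m', Gb b q m * Gp a m' p * g m m') *
          (dY a q * dX b p) := by
    have : ∀ q p a b, (A a b q p - ∑ m, ∑ m', Gb b q m * Gp a m' p * g m m') * (dY a q * dX b p)
        = ∑ l, ∑ k, (A a b q p - ∑ m, ∑ m', Gb b q m * Gp a m' p * g m m') *
          ((G l a * cB l q) * (G b k * cH k p)) := by
      intro q p a b
      rw [← hB, ← hH, Finset.sum_mul_sum, Finset.mul_sum]
      exact pull1 fun l => Finset.mul_sum _ _ _
    simp only [this]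
    simp only [mul_assoc _ (cB _ _), Finset.sum_mul _ _ (cB _ _ * cH _ _)]
    exact pull3 fun q => pull3 fun p => pull3 fun a => pull3 fun b => pull1 fun l => pull1 fun k =>
      by ring
  have e2 : ∑ q, ∑ p, ∑ a, ∑ b, (A a b q p - ∑ m, ∑ m', Gb b q m * Gp a m' p * g m m') *
          (dY a q * dX b p)
      = (∑ q, ∑ p, ∑ a, ∑ b, A a b q p * (dY a q * dX b p))
      - ((∑ q, ∑ p, ∑ a, ∑ b, (∑ m, ∑ m', Gb b q m * Gp a m' p * g m m') *
          ((∑ l, G l a * y2 q l) * dX b p))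
      + (∑ q, ∑ p, ∑ a, ∑ b, (∑ m, ∑ m', Gb b q m * Gp a m' p * g m m') *
          ((∑ l, Gb q l a * y1 l) * ∑ k, G b k * x2 p k))
      + (∑ q, ∑ p, ∑ a, ∑ b, (∑ m, ∑ m', Gb b q m * Gp a m' p * g m m') *
          ((∑ l, Gb q l a * y1 l) * ∑ k, Gp p b k * x1 k))) := by
    simp only [← Finset.sum_add_distrib, ← Finset.sum_sub_distrib]
    refine pull1 fun q => pull1 fun p => pull1 fun a => pull1 fun b => ?_
    simp only [hdX, hdY, Finset.sum_add_distrib]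
    ring
  have e3 : ∑ q, ∑ p, ∑ a, ∑ b, (∑ m, ∑ m', Gb b q m * Gp a m' p * g m m') *
          ((∑ l, G l a * y2 q l) * dX b p)
      = ∑ q, ∑ p, ∑ b, ∑ m, ∑ l, (Gb b q m * Gp m l p) * (y2 q l * dX b p) := by
    trans ∑ q, ∑ p, ∑ b, ∑ m, ∑ l,
        (Gb b q m * ∑ a, G l a * ∑ m', g m m' * Gp a m' p) * (y2 q l * dX b p)
    · simp only [Finset.sum_mul, Finset.mul_sum]
      exact pull1 fun q => pull1 fun p => pull2 fun b => pull3 fun m => pull2 fun l =>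
        pull1 fun a => pull1 fun m' => by ring
    · simp only [Kp]
  have e4 : ∑ q, ∑ p, ∑ a, ∑ b, (∑ m, ∑ m', Gb b q m * Gp a m' p * g m m') *
          ((∑ l, Gb q l a * y1 l) * ∑ k, G b k * x2 p k)
      = ∑ q, ∑ p, ∑ a, ∑ m', ∑ l, ∑ k,
          (Gb m' q k * Gp a m' p * Gb q l a) * (y1 l * x2 p k) := by
    trans ∑ q, ∑ p, ∑ a, ∑ m', ∑ l, ∑ k,
          ((∑ b, G b k * ∑ m, g m m' * Gb b q m) * Gp a m' p * Gb q l a) * (y1 l * x2 p k)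
    · simp only [Finset.sum_mul, Finset.mul_sum]
      exact pull1 fun q => pull1 fun p => pull1 fun a => pull5 fun m' => pull3 fun l =>
        pull2 fun k => pull1 fun b => pull1 fun m => by ring
    · simp only [Kb]
  have e5 : ∑ q, ∑ p, ∑ a, ∑ b, (∑ m, ∑ m', Gb b q m * Gp a m' p * g m m') *
          ((∑ l, Gb q l a * y1 l) * ∑ k, Gp p b k * x1 k)
      = ∑ l, ∑ k, Sco g Gp Gb l k * y1 l * x1 k := by
    simp only [Sco, Finset.sum_mul, Finset.mul_sum]
    exact pull6 fun l => pull5 fun k => pull5 fun m => pull5 fun m' => pull2 fun p =>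
        pull1 fun q => pull1 fun s => pull1 fun t => by ring
  rw [e1, e2, e3, e4, e5]
  simp only [neg_mul, Finset.sum_neg_distrib]
  ring

lemma P_alg {n : ℕ} (G g : Fin n → Fin n → ℂ) (Gp Gb : Fin n → Fin n → Fin n → ℂ)
    (Kp : ∀ l p m, ∑ a, G l a * ∑ m', g m m' * Gp a m' p = Gp m l p)
    (x1 y1 : Fin n → ℂ) (x2 y2 dX dY : Fin n → Fin n → ℂ)
    (F H ddX ddY W : Fin n → Fin n → Fin n → ℂ)
    (hdX : ∀ b p, dX b p = ∑ k, (Gp p b k * x1 k + G b k * x2 p k))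
    (hdY : ∀ a q, dY a q = ∑ l, (Gb q l a * y1 l + G l a * y2 q l))
    (F12 : ∀ l q t, F l q t = F q l t) (F23 : ∀ l q t, F l q t = F l t q)
    (hF : ∀ k q t, ∑ l, G l k * F l q t
      = ddY k t q - ∑ a, (-∑ m, g m q * Gb t a m) * dY k a)
    (hFF : ∀ k p t, ∑ q, G q p * ∑ l, G l k * F l q t = W k p t)
    (hHH : ∀ l q s, ∑ p, G q p * ∑ k, G l k * H k p s
      = ∑ p, (G q p * ddX l s p + Gp s q p * dX l p)) :
    (∑ l, ∑ k, ∑ q, ∑ p, ∑ t, ∑ s, G l k * G q p * G t s * F l q t * H k p s)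
      - ∑ l, ∑ k, Sco g Gp Gb l k * y1 l * x1 k =
    ((∑ l, ∑ s, ∑ p, W s p l * ddX l s p)
      + ∑ q, ∑ s, ∑ p, ∑ k, Gp s q p * (W s k q * x2 p k))
      + (∑ l, ∑ q, ∑ s, ∑ p, ∑ k, (Gp s q p * Gp p l k) * (ddY s l q * x1 k))
      + ∑ l, ∑ a, ∑ m, ∑ b, ∑ p, ∑ k, (Gb l a m * Gp m b p * Gp p l k) * (y2 a b * x1 k) := by
  have F13 : ∀ l q t, F l q t = F t q l := fun l q t => by
    rw [F12, F23, F12]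
  have e1 : ∑ l, ∑ k, ∑ q, ∑ p, ∑ t, ∑ s, G l k * G q p * G t s * F l q t * H k p s
      = ∑ l, ∑ q, ∑ t, ∑ s, F l q t * G t s * ∑ p, (G q p * ddX l s p + Gp s q p * dX l p) := by
    simp only [← hHH, Finset.mul_sum]
    exact pull1 fun l => pull2 fun q => pull3 fun t => pull3 fun s => pull2 fun p => pull1 fun k =>
      by ring
  have e2 : ∑ l, ∑ q, ∑ t, ∑ s, F l q t * G t s * ∑ p, (G q p * ddX l s p + Gp s q p * dX l p)
      = (∑ l, ∑ q, ∑ t, ∑ s, F l q t * G t s * ∑ p, G q p * ddX l s p)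
      + (∑ l, ∑ q, ∑ t, ∑ s, F l q t * G t s * ∑ p, Gp s q p * ∑ k, G l k * x2 p k)
      + (∑ l, ∑ q, ∑ t, ∑ s, F l q t * G t s * ∑ p, Gp s q p * ∑ k, Gp p l k * x1 k) := by
    simp only [← Finset.sum_add_distrib]
    refine pull1 fun l => pull1 fun q => pull1 fun t => pull1 fun s => ?_
    simp only [hdX, Finset.sum_add_distrib, mul_add]
    ring
  have e3 : ∑ l, ∑ q, ∑ t, ∑ s, F l q t * G t s * ∑ p, G q p * ddX l s p
      = ∑ l, ∑ s, ∑ p, W s p l * ddX l s p := by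
    simp only [← hFF, Finset.mul_sum, Finset.sum_mul]
    exact pull1 fun l => pull3 fun s => pull3 fun p => pull1 fun q => pull1 fun t => by
      rw [F13 l q t]; ring
  have e4 : ∑ l, ∑ q, ∑ t, ∑ s, F l q t * G t s * ∑ p, Gp s q p * ∑ k, G l k * x2 p k
      = ∑ q, ∑ s, ∑ p, ∑ k, Gp s q p * (W s k q * x2 p k) := by
    simp only [← hFF, Finset.mul_sum, Finset.sum_mul]
    exact pull2 fun q => pull3 fun s => pull3 fun p => pull3 fun k => pull1 fun l => pull1 fun t =>
      by rw [F23 l q t, F12 l t q]; ring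
  have e5 : ∑ l, ∑ q, ∑ t, ∑ s, F l q t * G t s * ∑ p, Gp s q p * ∑ k, Gp p l k * x1 k
      = ∑ l, ∑ q, ∑ s, ∑ p, ∑ k, (Gp s q p * Gp p l k) *
          ((ddY s l q - ∑ a, (-∑ m, g m q * Gb l a m) * dY s a) * x1 k) := by
    simp only [← hF, Finset.mul_sum, Finset.sum_mul]
    exact pull1 fun l => pull1 fun q => pull2 fun s => pull2 fun p => pull2 fun k => pull1 fun t =>
      by rw [F13 l q t]; ring
  have e6 : ∑ l, ∑ q, ∑ s, ∑ p, ∑ k, (Gp s q p * Gp p l k) *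
          ((ddY s l q - ∑ a, (-∑ m, g m q * Gb l a m) * dY s a) * x1 k)
      = (∑ l, ∑ q, ∑ s, ∑ p, ∑ k, (Gp s q p * Gp p l k) * (ddY s l q * x1 k))
      + (∑ l, ∑ q, ∑ s, ∑ p, ∑ k, (Gp s q p * Gp p l k) *
          ((∑ a, (∑ m, g m q * Gb l a m) * ∑ b, G b s * y2 a b) * x1 k))
      + (∑ l, ∑ q, ∑ s, ∑ p, ∑ k, (Gp s q p * Gp p l k) *
          ((∑ a, (∑ m, g m q * Gb l a m) * ∑ b, Gb a b s * y1 b) * x1 k)) := by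
    simp only [← Finset.sum_add_distrib]
    refine pull1 fun l => pull1 fun q => pull1 fun s => pull1 fun p => pull1 fun k => ?_
    simp only [hdY, Finset.sum_add_distrib, mul_add, neg_mul, Finset.sum_neg_distrib]
    ring
  have e7 : ∑ l, ∑ q, ∑ s, ∑ p, ∑ k, (Gp s q p * Gp p l k) *
          ((∑ a, (∑ m, g m q * Gb l a m) * ∑ b, G b s * y2 a b) * x1 k)
      = ∑ l, ∑ a, ∑ m, ∑ b, ∑ p, ∑ k, (Gb l a m * Gp m b p * Gp p l k) * (y2 a b * x1 k) := by
    trans ∑ l, ∑ a, ∑ m, ∑ b, ∑ p, ∑ k,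
        (Gb l a m * (∑ s, G b s * ∑ q, g m q * Gp s q p) * Gp p l k) * (y2 a b * x1 k)
    · simp only [Finset.mul_sum, Finset.sum_mul]
      -- l q s p k a b m
      exact pull1 fun l => pull5 fun a => pull6 fun m => pull5 fun b => pull3 fun p => pull3 fun k =>
        pull2 fun s => pull1 fun q => by ring
    · simp only [Kp]
  have e8 : ∑ l, ∑ q, ∑ s, ∑ p, ∑ k, (Gp s q p * Gp p l k) *
          ((∑ a, (∑ m, g m q * Gb l a m) * ∑ b, Gb a b s * y1 b) * x1 k)
      = ∑ l, ∑ k, Sco g Gp Gb l k * y1 l * x1 k := by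
    simp only [Sco, Finset.mul_sum, Finset.sum_mul]
    -- `l q s p k a b m` to `b k m q p a s l`
    refine (pull1 fun l => pull6 fun b => rfl).trans (pull2 fun b => ?_)
    exact pull5 fun k => pull6 fun m => pull2 fun q => pull3 fun p => pull3 fun a =>
      pull2 fun s => pull1 fun l => by ring
  rw [e1, e2, e3, e4, e5, e6, e7, e8]
  ring

/-! ### Closure properties of regular functions and operators -/

section Closure

variable {n : ℕ} {ginv : Fin n → Fin n → (Fin n → ℂ) → ℂ}

lemma Regular.mul {f g : (Fin n → ℂ) → ℂ} (hf : Regular n ginv f) (hg : Regular n ginv g) :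
    Regular n ginv (fun z => f z * g z) := Subalgebra.mul_mem _ hf hg

lemma Regular.add {f g : (Fin n → ℂ) → ℂ} (hf : Regular n ginv f) (hg : Regular n ginv g) :
    Regular n ginv (fun z => f z + g z) := Subalgebra.add_mem _ hf hg

lemma Regular.sub {f g : (Fin n → ℂ) → ℂ} (hf : Regular n ginv f) (hg : Regular n ginv g) :
    Regular n ginv (fun z => f z - g z) := Subalgebra.sub_mem _ hf hg

lemma Regular.neg {f : (Fin n → ℂ) → ℂ} (hf : Regular n ginv f) :
    Regular n ginv (fun z => - f z) := Subalgebra.neg_mem _ hf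

lemma Regular.one : Regular n ginv (fun _ => 1) := Subalgebra.one_mem _

lemma Regular.sum {m : ℕ} {f : Fin m → (Fin n → ℂ) → ℂ} (hf : ∀ i, Regular n ginv (f i)) :
    Regular n ginv (fun z => ∑ i, f i z) := by
  have : (fun z => ∑ i, f i z) = ∑ i, f i := by ext z; simp
  rw [this]
  exact Subalgebra.sum_mem _ fun i _ => hf i

lemma Regular.gen (A B : List (Fin n)) (q p : Fin n) :
    Regular n ginv (A.foldr (fun k g => wdP n k g) (B.foldr (fun l g => wdB n l g) (ginv q p))) :=
  Algebra.subset_adjoin ⟨A, B, q, p, rfl⟩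

/-- One-sided regular differential operators, built from the derivations `d`. -/
inductive IsD (n : ℕ) (ginv : Fin n → Fin n → (Fin n → ℂ) → ℂ)
    (d : Fin n → ((Fin n → ℂ) → ℂ) → (Fin n → ℂ) → ℂ) :
    (((Fin n → ℂ) → ℂ) → (Fin n → ℂ) → ℂ) → Prop
  | mono (b : (Fin n → ℂ) → ℂ) (B : List (Fin n)) (hb : Regular n ginv b) :
      IsD n ginv d (fun φ z => b z * (B.foldr (fun l g => d l g) φ) z)
  | zero : IsD n ginv d (fun _ _ => 0)
  | add (D D' : ((Fin n → ℂ) → ℂ) → (Fin n → ℂ) → ℂ) (h : IsD n ginv d D) (h' : IsD n ginv d D') :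
      IsD n ginv d (fun φ z => D φ z + D' φ z)

/-- Regular bidifferential operators. -/
inductive IsB (n : ℕ) (ginv : Fin n → Fin n → (Fin n → ℂ) → ℂ) :
    (((Fin n → ℂ) → ℂ) → ((Fin n → ℂ) → ℂ) → (Fin n → ℂ) → ℂ) → Prop
  | mono (b : (Fin n → ℂ) → ℂ) (B A : List (Fin n)) (hb : Regular n ginv b) :
      IsB n ginv (fun φ ψ z => b z * (B.foldr (fun l g => wdB n l g) φ) z *
        (A.foldr (fun k g => wdP n k g) ψ) z)
  | zero : IsB n ginv (fun _ _ _ => 0)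
  | add (T T' : ((Fin n → ℂ) → ℂ) → ((Fin n → ℂ) → ℂ) → (Fin n → ℂ) → ℂ)
      (h : IsB n ginv T) (h' : IsB n ginv T') : IsB n ginv (fun φ ψ z => T φ ψ z + T' φ ψ z)

variable {d : Fin n → ((Fin n → ℂ) → ℂ) → (Fin n → ℂ) → ℂ}

lemma IsD.base (B : List (Fin n)) : IsD n ginv d (fun φ z => (B.foldr (fun l g => d l g) φ) z) := by
  simpa using IsD.mono (d := d) (fun _ => (1 : ℂ)) B Regular.one

lemma IsD.smul {c : (Fin n → ℂ) → ℂ} (hc : Regular n ginv c)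
    {D : ((Fin n → ℂ) → ℂ) → (Fin n → ℂ) → ℂ} (h : IsD n ginv d D) :
    IsD n ginv d (fun φ z => c z * D φ z) := by
  induction h with
  | mono b B hb => simpa [mul_assoc] using IsD.mono (d := d) _ B (hc.mul hb)
  | zero => simpa using IsD.zero
  | add D D' _ _ h h' => simpa [mul_add] using h.add _ _ h'

lemma IsD.sum {m : ℕ} {D : Fin m → ((Fin n → ℂ) → ℂ) → (Fin n → ℂ) → ℂ}
    (h : ∀ i, IsD n ginv d (D i)) : IsD n ginv d (fun φ z => ∑ i, D i φ z) := by
  induction m with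
  | zero => simpa using IsD.zero
  | succ m ih =>
    simp only [Fin.sum_univ_succ]
    exact (h 0).add _ _ (ih fun i => h i.succ)

lemma IsB.sum {m : ℕ} {T : Fin m → ((Fin n → ℂ) → ℂ) → ((Fin n → ℂ) → ℂ) → (Fin n → ℂ) → ℂ}
    (h : ∀ i, IsB n ginv (T i)) : IsB n ginv (fun φ ψ z => ∑ i, T i φ ψ z) := by
  induction m with
  | zero => simpa using IsB.zero
  | succ m ih =>
    simp only [Fin.sum_univ_succ]
    exact (h 0).add _ _ (ih fun i => h i.succ)

lemma IsB.prod {D D' : ((Fin n → ℂ) → ℂ) → (Fin n → ℂ) → ℂ} (h : IsD n ginv (wdB n) D)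
    (h' : IsD n ginv (wdP n) D') : IsB n ginv (fun φ ψ z => D φ z * D' ψ z) := by
  induction h with
  | zero => simpa using IsB.zero
  | add D₁ D₂ _ _ h₁ h₂ => simpa [add_mul] using h₁.add _ _ h₂
  | mono b B hb =>
    induction h' with
    | zero => simpa using IsB.zero
    | add D₁ D₂ _ _ h₁ h₂ => simpa [mul_add] using h₁.add _ _ h₂
    | mono c A hc =>
      have := IsB.mono _ B A (hb.mul hc)
      convert this using 4
      ring

lemma IsB.tm {c : (Fin n → ℂ) → ℂ} (hc : Regular n ginv c)
    {D D' : ((Fin n → ℂ) → ℂ) → (Fin n → ℂ) → ℂ} (h : IsD n ginv (wdB n) D)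
    (h' : IsD n ginv (wdP n) D') : IsB n ginv (fun φ ψ z => c z * (D φ z * D' ψ z)) := by
  simpa [mul_assoc] using IsB.prod (h.smul hc) h'

lemma IsB.regularOp {U : Set (Fin n → ℂ)}
    {T T' : ((Fin n → ℂ) → ℂ) → ((Fin n → ℂ) → ℂ) → (Fin n → ℂ) → ℂ} (h : IsB n ginv T')
    (hT : ∀ φ ψ, Sm U φ → Sm U ψ → ∀ z ∈ U, T φ ψ z = T' φ ψ z) : RegularOp n U ginv T := by
  have key : ∃ (N : ℕ) (b : Fin N → (Fin n → ℂ) → ℂ) (A B : Fin N → List (Fin n)),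
      (∀ j, Regular n ginv (b j)) ∧ ∀ φ ψ : (Fin n → ℂ) → ℂ, ∀ z,
        T' φ ψ z = ∑ j, b j z * ((B j).foldr (fun l g => wdB n l g) φ) z *
          ((A j).foldr (fun k g => wdP n k g) ψ) z := by
    clear hT
    induction h with
    | mono b B A hb => exact ⟨1, fun _ => b, fun _ => A, fun _ => B, fun _ => hb, by simp⟩
    | zero => exact ⟨0, Fin.elim0, Fin.elim0, Fin.elim0, fun j => j.elim0, by simp⟩
    | add T₁ T₂ _ _ h₁ h₂ =>
      obtain ⟨N₁, b₁, A₁, B₁, r₁, e₁⟩ := h₁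
      obtain ⟨N₂, b₂, A₂, B₂, r₂, e₂⟩ := h₂
      refine ⟨N₁ + N₂, Fin.append b₁ b₂, Fin.append A₁ A₂, Fin.append B₁ B₂, ?_, ?_⟩
      · intro j
        refine Fin.addCases (fun i => ?_) (fun i => ?_) j
        · simpa using r₁ i
        · simpa using r₂ i
      · intro φ ψ z
        simp [Fin.sum_univ_add, e₁, e₂]
  obtain ⟨N, b, A, B, hb, e⟩ := key
  exact ⟨N, b, A, B, hb, fun φ ψ hφ hψ z hz => by rw [hT φ ψ hφ hψ z hz, e]⟩

/-! Regularity of the concrete building blocks. -/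

lemma rG (q p : Fin n) : Regular n ginv (fun z => ginv q p z) := Regular.gen [] [] q p
lemma rGp (s q p : Fin n) : Regular n ginv (fun z => wdP n s (ginv q p) z) := Regular.gen [s] [] q p
lemma rGb (s q p : Fin n) : Regular n ginv (fun z => wdB n s (ginv q p) z) := Regular.gen [] [s] q p
lemma rGpp (t s q p : Fin n) : Regular n ginv (fun z => wdP n t (wdP n s (ginv q p)) z) :=
  Regular.gen [t, s] [] q p
lemma rGbb (t s q p : Fin n) : Regular n ginv (fun z => wdB n t (wdB n s (ginv q p)) z) :=
  Regular.gen [] [t, s] q p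
lemma rA (k l q p : Fin n) : Regular n ginv (fun z => wdP n k (wdB n l (ginv q p)) z) :=
  Regular.gen [k] [l] q p

lemma D1 (k : Fin n) : IsD n ginv d (fun φ z => d k φ z) := IsD.base [k]
lemma D2 (p k : Fin n) : IsD n ginv d (fun φ z => d p (d k φ) z) := IsD.base [p, k]
lemma D3 (s p k : Fin n) : IsD n ginv d (fun φ z => d s (d p (d k φ)) z) := IsD.base [s, p, k]

lemma isD_dX (l p : Fin n) : IsD n ginv (wdP n) (dX n (-Complex.I) ginv l p) := by
  unfold dX
  simp only [← wdP_eq]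
  exact IsD.sum fun k => ((D1 k).smul (rGp p l k)).add _ _ ((D2 p k).smul (rG l k))

lemma isD_ddX (l s p : Fin n) : IsD n ginv (wdP n) (ddX n (-Complex.I) ginv l s p) := by
  unfold ddX
  simp only [← wdP_eq]
  exact IsD.sum fun k => (((D1 k).smul (rGpp s p l k)).add _ _ ((D2 s k).smul (rGp p l k))).add _ _
    (((D2 p k).smul (rGp s l k)).add _ _ ((D3 s p k).smul (rG l k)))

lemma isD_dY (l p : Fin n) :
    IsD n ginv (wdB n) (dX n Complex.I (fun a b => ginv b a) l p) := by
  unfold dX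
  simp only [← wdB_eq]
  exact IsD.sum fun k => ((D1 k).smul (rGb p k l)).add _ _ ((D2 p k).smul (rG k l))

lemma isD_ddY (l s p : Fin n) :
    IsD n ginv (wdB n) (ddX n Complex.I (fun a b => ginv b a) l s p) := by
  unfold ddX
  simp only [← wdB_eq]
  exact IsD.sum fun k => (((D1 k).smul (rGbb s p k l)).add _ _ ((D2 s k).smul (rGb p k l))).add _ _
    (((D2 p k).smul (rGb s k l)).add _ _ ((D3 s p k).smul (rG k l)))

lemma isD_W (k p t : Fin n) : IsD n ginv (wdB n) (fun φ z =>
    ∑ q, (ginv q p z * ddX n Complex.I (fun a b => ginv b a) k t q φ z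
      + wdB n t (ginv q p) z * dX n Complex.I (fun a b => ginv b a) k q φ z)) :=
  IsD.sum fun q => ((isD_ddY k t q).smul (rG q p)).add _ _ ((isD_dY k q).smul (rGb t q p))

end Closure

/-! ### Instances of the generic metric facts -/

lemma smPhic {n : ℕ} {U : Set (Fin n → ℂ)} {Φ : (Fin n → ℂ) → ℝ}
    (hΦ : ContDiffOn ℝ (⊤ : ℕ∞) Φ U) : Sm U (Phic n Φ) :=
  Complex.ofRealCLM.contDiff.comp_contDiffOn hΦ

lemma gdn_eq (n : ℕ) (Φ : (Fin n → ℂ) → ℝ) (k l : Fin n) :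
    gdn n Φ k l = wd n (-Complex.I) k (wd n Complex.I l (Phic n Φ)) := by
  rw [gdn, wdP_eq, wdB_eq]

section Inst

variable {n : ℕ} {U : Set (Fin n → ℂ)} {Φ : (Fin n → ℂ) → ℝ}
  {ginv : Fin n → Fin n → (Fin n → ℂ) → ℂ}

lemma metH (hU : IsOpen U) (hΦ : ContDiffOn ℝ (⊤ : ℕ∞) Φ U)
    (hginv : ∀ l k : Fin n, ContDiffOn ℝ (⊤ : ℕ∞) (ginv l k) U)
    (hinv1 : ∀ z ∈ U, ∀ l q : Fin n,
      (∑ k, ginv l k z * gdn n Φ k q z) = if l = q then 1 else 0)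
    (hinv2 : ∀ z ∈ U, ∀ p k : Fin n,
      (∑ l, gdn n Φ p l z * ginv l k z) = if p = k then 1 else 0) :
    Met n U (-Complex.I) (gdn n Φ) ginv where
  op := hU
  smM a b := by rw [gdn_eq]; exact ((smPhic hΦ).wd hU _ _).wd hU _ _
  smN := hginv
  inv1 := hinv1
  inv2 := hinv2
  sym k p t z hz := by
    rw [gdn_eq, gdn_eq]
    exact wd_comm hU ((smPhic hΦ).wd hU _ _) _ _ _ _ z hz

lemma wdB_gdn (hU : IsOpen U) (hΦ : ContDiffOn ℝ (⊤ : ℕ∞) Φ U) (s q l : Fin n) :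
    ∀ z ∈ U, wd n Complex.I q (gdn n Φ s l) z = g3a n Φ s q l z := by
  intro z hz
  rw [gdn_eq, g3a, wdP_eq, wdB_eq, wdB_eq]
  exact wd_comm hU ((smPhic hΦ).wd hU _ _) _ _ _ _ z hz

lemma metB (hU : IsOpen U) (hΦ : ContDiffOn ℝ (⊤ : ℕ∞) Φ U)
    (hginv : ∀ l k : Fin n, ContDiffOn ℝ (⊤ : ℕ∞) (ginv l k) U)
    (hinv1 : ∀ z ∈ U, ∀ l q : Fin n,
      (∑ k, ginv l k z * gdn n Φ k q z) = if l = q then 1 else 0)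
    (hinv2 : ∀ z ∈ U, ∀ p k : Fin n,
      (∑ l, gdn n Φ p l z * ginv l k z) = if p = k then 1 else 0) :
    Met n U Complex.I (fun a b => gdn n Φ b a) (fun a b => ginv b a) where
  op := hU
  smM a b := by rw [gdn_eq]; exact ((smPhic hΦ).wd hU _ _).wd hU _ _
  smN a b := hginv b a
  inv1 z hz l q := by
    simp only [mul_comm (ginv _ _ z), hinv2 z hz q l, eq_comm]
  inv2 z hz p k := by
    simp only [mul_comm (gdn _ _ _ _ z), hinv1 z hz k p, eq_comm]
  sym k p t z hz := by
    rw [wdB_gdn hU hΦ _ _ _ z hz, wdB_gdn hU hΦ _ _ _ z hz]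
    simp only [g3a, wdP_eq, wdB_eq]
    exact wd_congr hU (wd_comm hU (smPhic hΦ) _ _ _ _) _ _ z hz

lemma cdH2_eq (ψ : (Fin n → ℂ) → ℂ) (k p : Fin n) :
    cdH2 n Φ ginv ψ k p = cd2 n (-Complex.I) (gdn n Φ) ginv ψ k p := by
  funext z
  simp only [cdH2, cd2, GamH, Gam, g3h, gdn, wdP_eq]

lemma cdH3_eq (ψ : (Fin n → ℂ) → ℂ) (k p s : Fin n) :
    cdH3 n Φ ginv ψ k p s = cd3 n (-Complex.I) (gdn n Φ) ginv ψ k p s := by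
  funext z
  simp only [cdH3, cd3, cdH2_eq]
  simp only [GamH, Gam, g3h, gdn, wdP_eq]

lemma GamB_eq (hU : IsOpen U) (hΦ : ContDiffOn ℝ (⊤ : ℕ∞) Φ U) (t l q : Fin n) :
    ∀ z ∈ U, GamB n Φ ginv t q l z
      = Gam n Complex.I (fun a b => gdn n Φ b a) (fun a b => ginv b a) t l q z := by
  intro z hz
  simp only [GamB, Gam]
  exact Finset.sum_congr rfl fun s _ => by rw [wdB_gdn hU hΦ _ _ _ z hz]; ring

lemma cdB2_eq (hU : IsOpen U) (hΦ : ContDiffOn ℝ (⊤ : ℕ∞) Φ U)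
    (hm : Met n U Complex.I (fun a b => gdn n Φ b a) (fun a b => ginv b a))
    (φ : (Fin n → ℂ) → ℂ) (l q : Fin n) :
    ∀ z ∈ U, cdB2 n Φ ginv φ l q z
      = cd2 n Complex.I (fun a b => gdn n Φ b a) (fun a b => ginv b a) φ l q z := by
  intro z hz
  simp only [cdB2, cd2, wdB_eq, GamB_eq hU hΦ _ _ _ z hz, hm.Gam_sym hz _ l q]

lemma cdB3_eq (hU : IsOpen U) (hΦ : ContDiffOn ℝ (⊤ : ℕ∞) Φ U)
    (hm : Met n U Complex.I (fun a b => gdn n Φ b a) (fun a b => ginv b a))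
    (φ : (Fin n → ℂ) → ℂ) (l q t : Fin n) :
    ∀ z ∈ U, cdB3 n Φ ginv φ l q t z
      = cd3 n Complex.I (fun a b => gdn n Φ b a) (fun a b => ginv b a) φ l q t z := by
  intro z hz
  simp only [cdB3, cd3, wdB_eq, GamB_eq hU hΦ _ _ _ z hz, hm.Gam_sym hz _ l t, hm.Gam_sym hz _ q t,
    wd_congr hU (cdB2_eq hU hΦ hm φ l q) _ t z hz, fun a b => cdB2_eq hU hΦ hm φ a b z hz]

end Inst

/-- Proposition 1: each of `P - S`, `Q - S` and `R - S` is a regular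
bidifferential operator. -/
theorem stmt_0 (n : ℕ) (hn : 1 ≤ n) (U : Set (Fin n → ℂ)) (hU : IsOpen U)
    (Φ : (Fin n → ℂ) → ℝ) (hΦ : ContDiffOn ℝ (⊤ : ℕ∞) Φ U)
    (ginv : Fin n → Fin n → (Fin n → ℂ) → ℂ)
    (hginv : ∀ l k : Fin n, ContDiffOn ℝ (⊤ : ℕ∞) (ginv l k) U)
    (hinv1 : ∀ z ∈ U, ∀ l q : Fin n,
      (∑ k, ginv l k z * gdn n Φ k q z) = if l = q then 1 else 0)
    (hinv2 : ∀ z ∈ U, ∀ p k : Fin n,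
      (∑ l, gdn n Φ p l z * ginv l k z) = if p = k then 1 else 0) :
    RegularOp n U ginv
        (fun φ ψ z => Pop n Φ ginv φ ψ z - Sop n Φ ginv φ ψ z) ∧
      RegularOp n U ginv
        (fun φ ψ z => Qop n Φ ginv φ ψ z - Sop n Φ ginv φ ψ z) ∧
      RegularOp n U ginv
        (fun φ ψ z => Rop n Φ ginv φ ψ z - Sop n Φ ginv φ ψ z) := by

  have mH := metH hU hΦ hginv hinv1 hinv2
  have mB := metB hU hΦ hginv hinv1 hinv2
  have Kp : ∀ z ∈ U, ∀ l p m, ∑ a, ginv l a z * ∑ m', gdn n Φ m m' z * wdP n a (ginv m' p) z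
      = wdP n m (ginv l p) z := by
    intro z hz l p m
    simp only [wdP_eq]
    exact mH.K hz l p m
  have Kb : ∀ z ∈ U, ∀ l p m, ∑ a, ginv a l z * ∑ m', gdn n Φ m' m z * wdB n a (ginv p m') z
      = wdB n m (ginv p l) z := fun z hz l p m => mB.K hz l p m
  have Sb : ∀ z ∈ U, ∀ s k p, ∑ t, gdn n Φ t p z * wdB n k (ginv s t) z
      = ∑ t, gdn n Φ t k z * wdB n p (ginv s t) z := fun z hz s k p => mB.Msym hz s k p
  have hS : ∀ φ ψ z, Sop n Φ ginv φ ψ z = ∑ l, ∑ k, Sco (fun a b => gdn n Φ a b z)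
      (fun s a b => wdP n s (ginv a b) z) (fun s a b => wdB n s (ginv a b) z) l k
        * wdB n l φ z * wdP n k ψ z := fun φ ψ z => rfl
  have hdX : ∀ ψ z b p, dX n (-Complex.I) ginv b p ψ z
      = ∑ k, (wdP n p (ginv b k) z * wdP n k ψ z + ginv b k z * wdP n p (wdP n k ψ) z) := by
    intro ψ z b p
    simp only [dX, wdP_eq]
  have hdY : ∀ φ z a q, dX n Complex.I (fun a b => ginv b a) a q φ z
      = ∑ l, (wdB n q (ginv l a) z * wdB n l φ z + ginv l a z * wdB n q (wdB n l φ) z) :=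
    fun φ z a q => rfl
  refine ⟨?_, ?_, ?_⟩
  · refine IsB.regularOp (((((IsB.sum fun l => IsB.sum fun s => IsB.sum fun p =>
        IsB.prod (isD_W s p l) (isD_ddX l s p)).add _ _
      (IsB.sum fun q => IsB.sum fun s => IsB.sum fun p => IsB.sum fun k =>
        IsB.tm (rGp s q p) (isD_W s k q) (D2 p k))).add _ _
      (IsB.sum fun l => IsB.sum fun q => IsB.sum fun s => IsB.sum fun p => IsB.sum fun k =>
        IsB.tm ((rGp s q p).mul (rGp p l k)) (isD_ddY s l q) (D1 k))).add _ _
      (IsB.sum fun l => IsB.sum fun a => IsB.sum fun m => IsB.sum fun b => IsB.sum fun p =>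
        IsB.sum fun k => IsB.tm (((rGb l a m).mul (rGp m b p)).mul (rGp p l k)) (D2 a b)
          (D1 k)))) ?_
    intro φ ψ hφ hψ z hz
    rw [hS]
    simp only [Pop, cdH3_eq, fun l q t => cdB3_eq hU hΦ mB φ l q t z hz]
    refine P_alg (fun a b => ginv a b z) (fun a b => gdn n Φ a b z)
      (fun s a b => wdP n s (ginv a b) z) (fun s a b => wdB n s (ginv a b) z) (Kp z hz)
      (fun k => wdP n k ψ z) (fun l => wdB n l φ z) (fun p k => wdP n p (wdP n k ψ) z)
      (fun q l => wdB n q (wdB n l φ) z) (fun b p => dX n (-Complex.I) ginv b p ψ z)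
      (fun a q => dX n Complex.I (fun a b => ginv b a) a q φ z)
      (fun l q t => cd3 n Complex.I (fun a b => gdn n Φ b a) (fun a b => ginv b a) φ l q t z)
      (fun k p s => cd3 n (-Complex.I) (gdn n Φ) ginv ψ k p s z)
      (fun l s p => ddX n (-Complex.I) ginv l s p ψ z)
      (fun l s p => ddX n Complex.I (fun a b => ginv b a) l s p φ z)
      (fun k p t => ∑ q, (ginv q p z * ddX n Complex.I (fun a b => ginv b a) k t q φ z
        + wdB n t (ginv q p) z * dX n Complex.I (fun a b => ginv b a) k q φ z))
      (hdX ψ z) (hdY φ z) (fun l q t => mB.cd3_sym12 hφ l q t z hz)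
      (fun l q t => mB.cd3_sym23 hφ l q t z hz) ?_ ?_ ?_
    · intro k q t
      have h1 := mB.N_cd3 hφ k q t z hz
      simp only [mB.Gam_eq hz] at h1
      exact h1
    · exact fun k p t => mB.NN_cd3 hφ k p t z hz
    · intro l q s
      have h1 := mH.NN_cd3 hψ l q s z hz
      simp only [← wdP_eq] at h1
      exact h1
  · refine IsB.regularOp (((IsB.sum fun q => IsB.sum fun p => IsB.sum fun a => IsB.sum fun b =>
        IsB.tm (rA a b q p).neg (isD_dY a q) (isD_dX b p)).add _ _
      (IsB.sum fun q => IsB.sum fun p => IsB.sum fun b => IsB.sum fun m => IsB.sum fun l =>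
        IsB.tm ((rGb b q m).mul (rGp m l p)) (D2 q l) (isD_dX b p))).add _ _
      (IsB.sum fun q => IsB.sum fun p => IsB.sum fun a => IsB.sum fun m' => IsB.sum fun l =>
        IsB.sum fun k => IsB.tm (((rGb m' q k).mul (rGp a m' p)).mul (rGb q l a)) (D1 l)
          (D2 p k))) ?_
    intro φ ψ hφ hψ z hz
    rw [hS]
    simp only [Qop, Rup4, Rcur, cdH2_eq, fun l q => cdB2_eq hU hΦ mB φ l q z hz]
    exact Q_alg (fun a b => ginv a b z) (fun a b => gdn n Φ a b z)
      (fun s a b => wdP n s (ginv a b) z) (fun s a b => wdB n s (ginv a b) z)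
      (fun k l q p => wdP n k (wdB n l (ginv q p)) z) (Kp z hz) (Kb z hz)
      (fun k => wdP n k ψ z) (fun l => wdB n l φ z) (fun p k => wdP n p (wdP n k ψ) z)
      (fun q l => wdB n q (wdB n l φ) z)
      (fun l q => cd2 n Complex.I (fun a b => gdn n Φ b a) (fun a b => ginv b a) φ l q z)
      (fun k p => cd2 n (-Complex.I) (gdn n Φ) ginv ψ k p z)
      (fun b p => dX n (-Complex.I) ginv b p ψ z)
      (fun a q => dX n Complex.I (fun a b => ginv b a) a q φ z)
      (hdX ψ z) (hdY φ z) (fun a q => mB.N_cd2 a q z hz) (fun b p => mH.N_cd2 b p z hz)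
  · refine IsB.regularOp (IsB.sum fun l => IsB.sum fun k =>
      IsB.tm (((Regular.sum fun m => Regular.sum fun m' => Regular.sum fun p => Regular.sum fun q =>
          ((rG m' m).mul (rA m q l p)).mul (rA p m' q k)).sub
        (Regular.sum fun m => Regular.sum fun p => Regular.sum fun q => Regular.sum fun t =>
          ((rA m q l p).mul (rGb t q m)).mul (rGp p t k))).sub
        (Regular.sum fun a => Regular.sum fun m' => Regular.sum fun p => Regular.sum fun q =>
          ((rGb q l a).mul (rGp a m' p)).mul (rA p m' q k))) (D1 l) (D1 k)) ?_
    intro φ ψ hφ hψ z hz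
    rw [hS]
    simp only [Rop, Rcur, ← Finset.sum_sub_distrib, ← sub_mul]
    refine pull1 fun l => pull1 fun k => ?_
    rw [← mul_assoc]
    congr 2
    simp only [Finset.sum_sub_distrib]
    exact R_alg (fun a b => ginv a b z) (fun a b => gdn n Φ a b z)
      (fun s a b => wdP n s (ginv a b) z) (fun s a b => wdB n s (ginv a b) z)
      (fun k l q p => wdP n k (wdB n l (ginv q p)) z) (Kp z hz) (Kb z hz) (Sb z hz) l k
end
end

section
/- Set D₀(f,g) = f·g, D₁ = C₁, D₂ = C₂, D₃ = C̃₃. Then for every r ∈ {0,1,2,3} and all smooth f,g,h : U → ℂ, Σ_{i+j=r, i,j≥0} D_i(D_j(f,g), h) = Σ_{i+j=r, i,j≥0} D_i(f, D_j(g,h)) holds on U. Equivalently, f ∗̃ g = fg + ν C₁(f,g) + ν² C₂(f,g) + ν³ C̃₃(f,g) defines an associative product up to the third order in the formal parameter ν, i.e. modulo ν⁴ (Proposition 2 of the paper). -/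
open scoped BigOperators

noncomputable section

/-- `D₀(f,g) = fg`, `D₁ = C₁`, `D₂ = C₂`, `D₃ = C̃₃` (and `0` beyond). -/
def Dop (n : ℕ) (Φ : (Fin n → ℂ) → ℝ) (ginv : Fin n → Fin n → (Fin n → ℂ) → ℂ) :
    ℕ → ((Fin n → ℂ) → ℂ) → ((Fin n → ℂ) → ℂ) → (Fin n → ℂ) → ℂ
  | 0, f, g => fun z => f z * g z
  | 1, f, g => C1op n ginv f g
  | 2, f, g => C2op n Φ ginv f g
  | 3, f, g => C3top n Φ ginv f g
  | _ + 4, _, _ => fun _ => 0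

set_option linter.unusedSectionVars false

namespace KStar
section stage2
variable {A ι : Type*} [CommRing A] [Algebra ℂ A] [Fintype ι]

/-- Antiholomorphic Christoffel symbols. -/
def Gm (B D : ι → Derivation ℂ A A) (Φ : A) (t l q : ι) : A := D t (B l (B q Φ))

/-- second covariant derivative -/
def b2 (B D : ι → Derivation ℂ A A) (Φ : A) (f : A) (l q : ι) : A :=
  B q (B l f) - ∑ t, Gm B D Φ t q l * B t f

/-- third covariant derivative -/
def b3 (B D : ι → Derivation ℂ A A) (Φ : A) (f : A) (l q t : ι) : A :=
  B t (b2 B D Φ f l q) - ∑ a, Gm B D Φ a t l * b2 B D Φ f a q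
    - ∑ a, Gm B D Φ a t q * b2 B D Φ f l a

/-- order one -/
def c1 (B D : ι → Derivation ℂ A A) (f h : A) : A := ∑ l, B l f * D l h

/-- order two -/
def c2 (B D : ι → Derivation ℂ A A) (Φ : A) (f h : A) : A :=
  (1 / 2 : ℂ) • ∑ l, ∑ q, b2 B D Φ f l q * D l (D q h)

/-- order three, without the biderivation term -/
def c3 (B D : ι → Derivation ℂ A A) (Φ : A) (f h : A) : A :=
  (1 / 6 : ℂ) • (∑ l, ∑ q, ∑ t, b3 B D Φ f l q t * D l (D q (D t h)))
  - (1 / 4 : ℂ) • (∑ l, ∑ q, ∑ a, ∑ b, D l (Gm B D Φ q a b) * b2 B D Φ f l q * D a (D b h))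

variable (B D : ι → Derivation ℂ A A) (Φ : A)
variable (hBB : ∀ k l a, B k (B l a) = B l (B k a)) (hDD : ∀ k l a, D k (D l a) = D l (D k a))
variable (hBD : ∀ q l a, B q (D l a) = D l (B q a) - ∑ b, Gm B D Φ l b q * D b a)

include hBB in
lemma Gm_symm (t l q : ι) : Gm B D Φ t l q = Gm B D Φ t q l := by
  simp [Gm, hBB l q]

include hBB in
lemma b2_symm (f : A) (l q : ι) : b2 B D Φ f l q = b2 B D Φ f q l := by
  simp only [b2, hBB q l, Gm_symm B D Φ hBB _ q l]

include hBB in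
lemma b3_symm12 (f : A) (l q t : ι) : b3 B D Φ f l q t = b3 B D Φ f q l t := by
  simp only [b3, b2_symm B D Φ hBB f l q]
  rw [sub_sub, sub_sub, add_comm]
  simp only [fun a => b2_symm B D Φ hBB f a q, fun a => b2_symm B D Φ hBB f l a]

include hBB hBD in
lemma b3_symm23 (f : A) (l q t : ι) : b3 B D Φ f l q t = b3 B D Φ f l t q := by
  have h1 : ∀ a t l q, B t (Gm B D Φ a l q) = D a (B t (B l (B q Φ))) - ∑ b, Gm B D Φ a b t * Gm B D Φ b l q := by
    intro a t l q
    rw [Gm, hBD]; rfl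
  have key : ∀ q t, b3 B D Φ f l q t = B t (B q (B l f)) - ∑ a, D a (B t (B q (B l Φ))) * B a f
      + (∑ a, ∑ b, (Gm B D Φ a b t * Gm B D Φ b q l * B a f + Gm B D Φ a b q * Gm B D Φ b t l * B a f
        + Gm B D Φ a l b * Gm B D Φ b t q * B a f))
      - (∑ a, Gm B D Φ a q l * B t (B a f) + ∑ a, Gm B D Φ a t l * B q (B a f)
        + ∑ a, Gm B D Φ a t q * B l (B a f)) := by
    intro q t
    have e1 : ∑ a, ∑ b, Gm B D Φ a b q * Gm B D Φ b t l * B a f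
        = ∑ a, Gm B D Φ a t l * ∑ b, Gm B D Φ b q a * B b f := by
      rw [Finset.sum_comm]
      simp only [Finset.mul_sum]
      refine Finset.sum_congr rfl fun a _ => Finset.sum_congr rfl fun b _ => ?_
      rw [Gm_symm B D Φ hBB b a q]; ring
    have e2 : ∑ a, ∑ b, Gm B D Φ a l b * Gm B D Φ b t q * B a f
        = ∑ a, Gm B D Φ a t q * ∑ b, Gm B D Φ b a l * B b f := by
      rw [Finset.sum_comm]
      simp only [Finset.mul_sum]
      refine Finset.sum_congr rfl fun a _ => Finset.sum_congr rfl fun b _ => ?_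
      rw [Gm_symm B D Φ hBB b a l]; ring
    simp only [Finset.sum_add_distrib]
    rw [e1, e2]
    simp only [b3, b2, map_sub, map_sum, Derivation.leibniz, smul_eq_mul, h1, mul_sub,
      Finset.sum_sub_distrib, Finset.sum_add_distrib, hBB _ l]
    have e3 : ∑ a, B a f * ∑ b, Gm B D Φ a b t * Gm B D Φ b q l
       = ∑ a, ∑ b, Gm B D Φ a b t * Gm B D Φ b q l * B a f := by
      simp only [Finset.mul_sum]
      refine Finset.sum_congr rfl fun a _ => Finset.sum_congr rfl fun b _ => ?_
      ring
    rw [e3]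
    simp only [mul_comm (B _ f)]
    ring
  rw [key q t, key t q]
  simp only [hBB t q, Gm_symm B D Φ hBB _ t q, Finset.sum_add_distrib]
  ring

include hDD in
lemma K_symm (l q a b : ι) : D l (Gm B D Φ q a b) = D q (Gm B D Φ l a b) := by
  simp [Gm, hDD l q]

lemma b2_mul (f g : A) (l q : ι) : b2 B D Φ (f * g) l q =
    b2 B D Φ f l q * g + B l f * B q g + B q f * B l g + f * b2 B D Φ g l q := by
  simp only [b2, Derivation.leibniz, map_add, smul_eq_mul, mul_add, Finset.sum_add_distrib, sub_mul,
    mul_sub, Finset.mul_sum, Finset.sum_mul]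
  have e1 : ∑ x, Gm B D Φ x q l * (f * B x g) = ∑ x, f * (Gm B D Φ x q l * B x g) :=
    Finset.sum_congr rfl fun x _ => by ring
  have e2 : ∑ x, Gm B D Φ x q l * (g * B x f) = ∑ x, Gm B D Φ x q l * B x f * g :=
    Finset.sum_congr rfl fun x _ => by ring
  rw [e1, e2]; ring

lemma b3_mul (f g : A) (l q t : ι) : b3 B D Φ (f * g) l q t =
    b3 B D Φ f l q t * g + f * b3 B D Φ g l q t
    + (b2 B D Φ f l q * B t g + b2 B D Φ f l t * B q g + b2 B D Φ f q t * B l g)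
    + (B t f * b2 B D Φ g l q + B q f * b2 B D Φ g l t + B l f * b2 B D Φ g q t) := by
  simp only [b3, b2_mul]
  have e1 : ∀ l q : ι, ∑ a, Gm B D Φ a t l * (b2 B D Φ f a q * g + B a f * B q g + B q f * B a g + f * b2 B D Φ g a q)
     = (∑ a, Gm B D Φ a t l * b2 B D Φ f a q) * g + f * (∑ a, Gm B D Φ a t l * b2 B D Φ g a q)
      + (∑ a, Gm B D Φ a t l * B a f) * B q g + B q f * (∑ a, Gm B D Φ a t l * B a g) := by
    intro l q
    simp only [Finset.mul_sum, Finset.sum_mul, ← Finset.sum_add_distrib]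
    exact Finset.sum_congr rfl fun x _ => by ring
  have e2 : ∀ l q : ι, ∑ a, Gm B D Φ a t q * (b2 B D Φ f l a * g + B l f * B a g + B a f * B l g + f * b2 B D Φ g l a)
     = (∑ a, Gm B D Φ a t q * b2 B D Φ f l a) * g + f * (∑ a, Gm B D Φ a t q * b2 B D Φ g l a)
      + (∑ a, Gm B D Φ a t q * B a f) * B l g + B l f * (∑ a, Gm B D Φ a t q * B a g) := by
    intro l q
    simp only [Finset.mul_sum, Finset.sum_mul, ← Finset.sum_add_distrib]
    exact Finset.sum_congr rfl fun x _ => by ring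
  rw [e1, e2]
  have e3 : ∀ (f : A) (l q : ι), B q (B l f) = b2 B D Φ f l q + ∑ t, Gm B D Φ t q l * B t f := by
    intro f l q; simp [b2]
  simp only [map_add, Derivation.leibniz, smul_eq_mul]
  simp only [e3 _ l t, e3 _ q t]
  ring


include hBD in
lemma B_contr (X : ι → A) (w : A) (t : ι) : B t (∑ l, X l * D l w) =
    ∑ l, (B t (X l) - ∑ a, Gm B D Φ a l t * X a) * D l w + ∑ l, X l * D l (B t w) := by
  simp only [map_sum, Derivation.leibniz, smul_eq_mul, hBD, sub_mul, mul_sub,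
    Finset.sum_add_distrib, Finset.sum_sub_distrib]
  have e : ∑ x, X x * ∑ b, Gm B D Φ x b t * D b w = ∑ x, (∑ a, Gm B D Φ a x t * X a) * D x w := by
    simp only [Finset.mul_sum, Finset.sum_mul]
    rw [Finset.sum_comm]
    refine Finset.sum_congr rfl fun a _ => Finset.sum_congr rfl fun b _ => ?_
    ring
  rw [e]
  simp only [mul_comm (D _ w)]
  ring

include hBB hBD in
lemma B_c1 (f g : A) (q : ι) : B q (c1 B D f g) =
    ∑ l, b2 B D Φ f l q * D l g + ∑ l, B l f * D l (B q g) := by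
  rw [c1, B_contr B D Φ hBD]
  simp only [b2, Gm_symm B D Φ hBB _ _ q]

include hBB hBD in
lemma b2_c1 (f g : A) (q t : ι) : b2 B D Φ (c1 B D f g) q t =
    ∑ l, b3 B D Φ f l q t * D l g + ∑ l, b2 B D Φ f l q * D l (B t g)
    + ∑ l, b2 B D Φ f l t * D l (B q g) + ∑ l, B l f * D l (b2 B D Φ g q t)
    + ∑ l, ∑ a, B l f * D l (Gm B D Φ a q t) * B a g := by
  have e0 : ∀ l, D l (b2 B D Φ g q t) = D l (B t (B q g)) - ∑ a, D l (Gm B D Φ a q t) * B a g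
      - ∑ a, Gm B D Φ a q t * D l (B a g) := by
    intro l
    simp only [b2, map_sub, map_sum, Derivation.leibniz, smul_eq_mul, Finset.sum_add_distrib,
      Gm_symm B D Φ hBB _ t q]
    simp only [mul_comm (B _ g)]
    ring
  have e1 : ∑ a, Gm B D Φ a t q * (∑ l, b2 B D Φ f l a * D l g + ∑ l, B l f * D l (B a g))
     = ∑ l, (∑ a, Gm B D Φ a t q * b2 B D Φ f l a) * D l g
      + ∑ l, B l f * ∑ a, Gm B D Φ a q t * D l (B a g) := by
    simp only [mul_add, Finset.sum_add_distrib]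
    simp only [Finset.mul_sum, Finset.sum_mul]
    congr 1
    · rw [Finset.sum_comm]
      exact Finset.sum_congr rfl fun a _ => Finset.sum_congr rfl fun b _ => by ring
    · rw [Finset.sum_comm]
      exact Finset.sum_congr rfl fun a _ => Finset.sum_congr rfl fun b _ => by
        rw [Gm_symm B D Φ hBB _ t q]; ring
  have e2 : ∑ l, ∑ a, B l f * D l (Gm B D Φ a q t) * B a g
      = ∑ l, B l f * ∑ a, D l (Gm B D Φ a q t) * B a g := by
    simp only [Finset.mul_sum, mul_assoc]
  have e3 : ∀ l, b2 B D Φ f l t = B t (B l f) - ∑ a, Gm B D Φ a l t * B a f := by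
    intro l; simp only [b2, Gm_symm B D Φ hBB _ t l]
  conv_lhs => rw [b2]
  simp only [B_c1 B D Φ hBB hBD, map_add]
  rw [e1, B_contr B D Φ hBD, B_contr B D Φ hBD, e2]
  simp only [b3, e0, e3 _, Gm_symm B D Φ hBB _ _ t, sub_mul, mul_sub, Finset.sum_sub_distrib]
  ring

include hBB hBD in
lemma B_c2 (f g : A) (t : ι) : B t (∑ l, ∑ q, b2 B D Φ f l q * D l (D q g)) =
    ∑ l, ∑ q, b3 B D Φ f l q t * D l (D q g)
    + ∑ l, ∑ q, b2 B D Φ f l q * D l (D q (B t g))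
    - ∑ l, ∑ q, ∑ b, D l (Gm B D Φ q b t) * b2 B D Φ f l q * D b g := by
  have e1 : ∀ q, B t (∑ l, b2 B D Φ f l q * D l (D q g)) =
     ∑ l, (B t (b2 B D Φ f l q) - ∑ a, Gm B D Φ a l t * b2 B D Φ f a q) * D l (D q g)
     + (∑ l, b2 B D Φ f l q * D l (D q (B t g))
       - ∑ l, ∑ b, D l (Gm B D Φ q b t) * b2 B D Φ f l q * D b g
       - ∑ l, ∑ b, Gm B D Φ q b t * b2 B D Φ f l q * D l (D b g)) := by
    intro q
    rw [B_contr B D Φ hBD]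
    congr 1
    rw [← Finset.sum_sub_distrib, ← Finset.sum_sub_distrib]
    refine Finset.sum_congr rfl fun l _ => ?_
    rw [hBD]
    simp only [map_sub, map_sum, Derivation.leibniz, smul_eq_mul, mul_sub, Finset.mul_sum,
      mul_add, Finset.sum_add_distrib]
    have h1 : ∑ x, b2 B D Φ f l q * (D x g * D l (Gm B D Φ q x t))
      = ∑ b, D l (Gm B D Φ q b t) * b2 B D Φ f l q * D b g :=
      Finset.sum_congr rfl fun x _ => by ring
    have h2 : ∑ x, b2 B D Φ f l q * (Gm B D Φ q x t * D l (D x g))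
      = ∑ b, Gm B D Φ q b t * b2 B D Φ f l q * D l (D b g) :=
      Finset.sum_congr rfl fun x _ => by ring
    rw [h1, h2]; ring
  rw [Finset.sum_comm, map_sum]
  simp only [e1, b3, Finset.sum_add_distrib, Finset.sum_sub_distrib, sub_mul,
    Gm_symm B D Φ hBB _ t]
  have e2 : ∑ q, ∑ l, ∑ b, Gm B D Φ q b t * b2 B D Φ f l q * D l (D b g)
    = ∑ l, ∑ q, (∑ a, Gm B D Φ a q t * b2 B D Φ f l a) * D l (D q g) := by
    rw [Finset.sum_comm]
    refine Finset.sum_congr rfl fun l _ => ?_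
    rw [Finset.sum_comm]
    simp only [Finset.sum_mul]
  rw [e2]
  rw [Finset.sum_comm (f := fun q l => B t (b2 B D Φ f l q) * D l (D q g)),
    Finset.sum_comm (f := fun q l => (∑ a, Gm B D Φ a l t * b2 B D Φ f a q) * D l (D q g)),
    Finset.sum_comm (f := fun q l => b2 B D Φ f l q * D l (D q (B t g))),
    Finset.sum_comm (f := fun q l => ∑ b, D l (Gm B D Φ q b t) * b2 B D Φ f l q * D b g)]
  ring


lemma s213 (F : ι → ι → ι → A) : ∑ l, ∑ q, ∑ t, F l q t = ∑ l, ∑ q, ∑ t, F q l t :=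
  Finset.sum_comm

lemma s132 (F : ι → ι → ι → A) : ∑ l, ∑ q, ∑ t, F l q t = ∑ l, ∑ q, ∑ t, F l t q :=
  Finset.sum_congr rfl fun _ _ => Finset.sum_comm

lemma congr3 {F G : ι → ι → ι → A} (h : ∀ l q t, F l q t = G l q t) :
    ∑ l, ∑ q, ∑ t, F l q t = ∑ l, ∑ q, ∑ t, G l q t :=
  Finset.sum_congr rfl fun l _ => Finset.sum_congr rfl fun q _ =>
    Finset.sum_congr rfl fun t _ => h l q t

lemma congr4 {F G : ι → ι → ι → ι → A} (h : ∀ l q t s, F l q t s = G l q t s) :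
    ∑ l, ∑ q, ∑ t, ∑ s, F l q t s = ∑ l, ∑ q, ∑ t, ∑ s, G l q t s :=
  Finset.sum_congr rfl fun l _ => congr3 (h l)

include hBB hDD in
lemma L1 (f g h : A) :
    ∑ l, ∑ q, ∑ t, b3 B D Φ (f * g) l q t * D l (D q (D t h)) =
    (∑ l, ∑ q, ∑ t, b3 B D Φ f l q t * D l (D q (D t h))) * g
    + f * (∑ l, ∑ q, ∑ t, b3 B D Φ g l q t * D l (D q (D t h)))
    + 3 * (∑ l, ∑ q, ∑ t, b2 B D Φ f l q * B t g * D l (D q (D t h)))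
    + 3 * (∑ l, ∑ q, ∑ t, B l f * b2 B D Φ g q t * D l (D q (D t h))) := by
  have h1 : ∑ l, ∑ q, ∑ t, b2 B D Φ f l t * B q g * D l (D q (D t h))
      = ∑ l, ∑ q, ∑ t, b2 B D Φ f l q * B t g * D l (D q (D t h)) := by
    rw [s132]; exact congr3 fun l q t => by rw [hDD t q]
  have h2 : ∑ l, ∑ q, ∑ t, b2 B D Φ f q t * B l g * D l (D q (D t h))
      = ∑ l, ∑ q, ∑ t, b2 B D Φ f l q * B t g * D l (D q (D t h)) := by
    rw [← h1, s213]; exact congr3 fun l q t => by rw [hDD l q]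
  have h3 : ∑ l, ∑ q, ∑ t, B q f * b2 B D Φ g l t * D l (D q (D t h))
      = ∑ l, ∑ q, ∑ t, B l f * b2 B D Φ g q t * D l (D q (D t h)) := by
    rw [s213]; exact congr3 fun l q t => by rw [hDD l q]
  have h4 : ∑ l, ∑ q, ∑ t, B t f * b2 B D Φ g l q * D l (D q (D t h))
      = ∑ l, ∑ q, ∑ t, B l f * b2 B D Φ g q t * D l (D q (D t h)) := by
    rw [← h3, s132]; exact congr3 fun l q t => by rw [hDD t q]
  simp only [b3_mul, add_mul, Finset.sum_add_distrib]
  rw [h1, h2, h3, h4]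
  have h5 : ∑ l, ∑ q, ∑ t, b3 B D Φ f l q t * g * D l (D q (D t h))
     = (∑ l, ∑ q, ∑ t, b3 B D Φ f l q t * D l (D q (D t h))) * g := by
    simp only [Finset.sum_mul]; exact congr3 fun l q t => by ring
  have h6 : ∑ l, ∑ q, ∑ t, f * b3 B D Φ g l q t * D l (D q (D t h))
     = f * (∑ l, ∑ q, ∑ t, b3 B D Φ g l q t * D l (D q (D t h))) := by
    simp only [Finset.mul_sum]; exact congr3 fun l q t => by ring
  rw [h5, h6]; ring

include hDD in
lemma L2 (f g h : A) :
    ∑ l, ∑ q, ∑ a, ∑ b, D l (Gm B D Φ q a b) * b2 B D Φ (f * g) l q * D a (D b h) =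
    (∑ l, ∑ q, ∑ a, ∑ b, D l (Gm B D Φ q a b) * b2 B D Φ f l q * D a (D b h)) * g
    + f * (∑ l, ∑ q, ∑ a, ∑ b, D l (Gm B D Φ q a b) * b2 B D Φ g l q * D a (D b h))
    + 2 * ∑ l, ∑ q, ∑ a, ∑ b, D l (Gm B D Φ q a b) * (B l f * B q g) * D a (D b h) := by
  have h1 : ∑ l, ∑ q, ∑ a, ∑ b, D l (Gm B D Φ q a b) * (B q f * B l g) * D a (D b h)
      = ∑ l, ∑ q, ∑ a, ∑ b, D l (Gm B D Φ q a b) * (B l f * B q g) * D a (D b h) := by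
    rw [Finset.sum_comm]; exact congr4 fun l q a b => by rw [K_symm B D Φ hDD l q]
  simp only [b2_mul, add_mul, mul_add, Finset.sum_add_distrib]
  rw [h1]
  simp only [Finset.sum_mul, Finset.mul_sum]
  have h5 : ∑ l, ∑ q, ∑ a, ∑ b, D l (Gm B D Φ q a b) * (b2 B D Φ f l q * g) * D a (D b h)
     = ∑ l, ∑ q, ∑ a, ∑ b, D l (Gm B D Φ q a b) * b2 B D Φ f l q * D a (D b h) * g :=
    congr4 fun l q a b => by ring
  have h6 : ∑ l, ∑ q, ∑ a, ∑ b, D l (Gm B D Φ q a b) * (f * b2 B D Φ g l q) * D a (D b h)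
     = ∑ l, ∑ q, ∑ a, ∑ b, f * (D l (Gm B D Φ q a b) * b2 B D Φ g l q * D a (D b h)) :=
    congr4 fun l q a b => by ring
  rw [h5, h6]
  simp only [← Finset.mul_sum]
  ring

include hBB hDD hBD in
lemma L3 (f g h : A) :
    ∑ q, ∑ t, b2 B D Φ (c1 B D f g) q t * D q (D t h) =
    ∑ l, ∑ q, ∑ t, b3 B D Φ f l q t * D l g * D q (D t h)
    + 2 * ∑ l, ∑ q, ∑ t, b2 B D Φ f l q * D l (B t g) * D q (D t h)
    + ∑ l, ∑ q, ∑ t, B l f * D l (b2 B D Φ g q t) * D q (D t h)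
    + ∑ l, ∑ q, ∑ a, ∑ b, D l (Gm B D Φ q a b) * (B l f * B q g) * D a (D b h) := by
  have cyc : ∀ F : ι → ι → ι → A, ∑ q, ∑ t, ∑ l, F l q t = ∑ l, ∑ q, ∑ t, F l q t := by
    intro F; rw [s132, s213]
  simp only [b2_c1 B D Φ hBB hBD, add_mul, Finset.sum_add_distrib]
  simp only [Finset.sum_mul]
  rw [cyc fun l q t => b3 B D Φ f l q t * D l g * D q (D t h),
    cyc fun l q t => b2 B D Φ f l q * D l (B t g) * D q (D t h),
    cyc fun l q t => b2 B D Φ f l t * D l (B q g) * D q (D t h),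
    cyc fun l q t => B l f * D l (b2 B D Φ g q t) * D q (D t h),
    cyc fun l q t => ∑ a, B l f * D l (Gm B D Φ a q t) * B a g * D q (D t h)]
  have h1 : ∑ l, ∑ q, ∑ t, b2 B D Φ f l t * D l (B q g) * D q (D t h)
      = ∑ l, ∑ q, ∑ t, b2 B D Φ f l q * D l (B t g) * D q (D t h) := by
    rw [s132]; exact congr3 fun l q t => by rw [hDD t q]
  have h2 : ∑ l, ∑ q, ∑ t, ∑ a, B l f * D l (Gm B D Φ a q t) * B a g * D q (D t h)
      = ∑ l, ∑ q, ∑ a, ∑ b, D l (Gm B D Φ q a b) * (B l f * B q g) * D a (D b h) := by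
    refine Finset.sum_congr rfl fun l _ => ?_
    rw [cyc fun a q t => B l f * D l (Gm B D Φ a q t) * B a g * D q (D t h)]
    exact congr3 fun l q t => by ring
  rw [h1, h2]; ring

include hBB hBD in
lemma L4 (f g h : A) :
    ∑ t, B t (∑ l, ∑ q, b2 B D Φ f l q * D l (D q g)) * D t h =
    ∑ l, ∑ q, ∑ t, b3 B D Φ f l q t * D l (D q g) * D t h
    + ∑ l, ∑ q, ∑ t, b2 B D Φ f l q * D l (D q (B t g)) * D t h
    - ∑ l, ∑ q, ∑ a, ∑ b, D l (Gm B D Φ q a b) * b2 B D Φ f l q * (D a g * D b h) := by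
  have cyc : ∀ F : ι → ι → ι → A, ∑ t, ∑ l, ∑ q, F l q t = ∑ l, ∑ q, ∑ t, F l q t := by
    intro F; rw [s213, s132]
  simp only [B_c2 B D Φ hBB hBD, add_mul, sub_mul, Finset.sum_add_distrib, Finset.sum_sub_distrib]
  simp only [Finset.sum_mul]
  rw [cyc fun l q t => b3 B D Φ f l q t * D l (D q g) * D t h,
    cyc fun l q t => b2 B D Φ f l q * D l (D q (B t g)) * D t h,
    cyc fun l q t => ∑ b, D l (Gm B D Φ q b t) * b2 B D Φ f l q * D b g * D t h]
  congr 1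
  refine Finset.sum_congr rfl fun l _ => Finset.sum_congr rfl fun q _ => ?_
  rw [Finset.sum_comm]
  exact Finset.sum_congr rfl fun l _ => Finset.sum_congr rfl fun q _ => by ring

include hBB hBD hDD in
lemma R1 (f g h : A) :
    ∑ l, ∑ q, ∑ t, b3 B D Φ f l q t * D l (D q (D t (g * h))) =
    (∑ l, ∑ q, ∑ t, b3 B D Φ f l q t * D l (D q (D t g))) * h
    + g * (∑ l, ∑ q, ∑ t, b3 B D Φ f l q t * D l (D q (D t h)))
    + 3 * (∑ l, ∑ q, ∑ t, b3 B D Φ f l q t * D l (D q g) * D t h)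
    + 3 * (∑ l, ∑ q, ∑ t, b3 B D Φ f l q t * D l g * D q (D t h)) := by
  have h1 : ∑ l, ∑ q, ∑ t, b3 B D Φ f l q t * D l (D t g) * D q h
      = ∑ l, ∑ q, ∑ t, b3 B D Φ f l q t * D l (D q g) * D t h := by
    rw [s132]; exact congr3 fun l q t => by rw [b3_symm23 B D Φ hBB hBD]
  have h2 : ∑ l, ∑ q, ∑ t, b3 B D Φ f l q t * D q (D t g) * D l h
      = ∑ l, ∑ q, ∑ t, b3 B D Φ f l q t * D l (D q g) * D t h := by
    rw [← h1, s213]; exact congr3 fun l q t => by rw [b3_symm12 B D Φ hBB]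
  have h3 : ∑ l, ∑ q, ∑ t, b3 B D Φ f l q t * D q g * D l (D t h)
      = ∑ l, ∑ q, ∑ t, b3 B D Φ f l q t * D l g * D q (D t h) := by
    rw [s213]; exact congr3 fun l q t => by rw [b3_symm12 B D Φ hBB]
  have h4 : ∑ l, ∑ q, ∑ t, b3 B D Φ f l q t * D t g * D l (D q h)
      = ∑ l, ∑ q, ∑ t, b3 B D Φ f l q t * D l g * D q (D t h) := by
    rw [← h3, s132]; exact congr3 fun l q t => by rw [b3_symm23 B D Φ hBB hBD]
  have h5 : ∀ l q t, b3 B D Φ f l q t * D l (D q (D t (g * h)))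
      = b3 B D Φ f l q t * D l (D q (D t g)) * h + g * (b3 B D Φ f l q t * D l (D q (D t h)))
      + b3 B D Φ f l q t * D l (D q g) * D t h + b3 B D Φ f l q t * D l (D t g) * D q h
      + b3 B D Φ f l q t * D q (D t g) * D l h + b3 B D Φ f l q t * D l g * D q (D t h)
      + b3 B D Φ f l q t * D q g * D l (D t h) + b3 B D Φ f l q t * D t g * D l (D q h) := by
    intro l q t
    simp only [Derivation.leibniz, smul_eq_mul, map_add]
    ring
  rw [congr3 h5]
  simp only [Finset.sum_add_distrib]
  rw [h1, h2, h3, h4]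
  simp only [← Finset.mul_sum, ← Finset.sum_mul]
  ring

include hBB hDD in
lemma R2 (f g h : A) :
    ∑ l, ∑ q, ∑ a, ∑ b, D l (Gm B D Φ q a b) * b2 B D Φ f l q * D a (D b (g * h)) =
    (∑ l, ∑ q, ∑ a, ∑ b, D l (Gm B D Φ q a b) * b2 B D Φ f l q * D a (D b g)) * h
    + g * (∑ l, ∑ q, ∑ a, ∑ b, D l (Gm B D Φ q a b) * b2 B D Φ f l q * D a (D b h))
    + 2 * ∑ l, ∑ q, ∑ a, ∑ b, D l (Gm B D Φ q a b) * b2 B D Φ f l q * (D a g * D b h) := by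
  have h1 : ∑ l, ∑ q, ∑ a, ∑ b, D l (Gm B D Φ q a b) * b2 B D Φ f l q * (D b g * D a h)
      = ∑ l, ∑ q, ∑ a, ∑ b, D l (Gm B D Φ q a b) * b2 B D Φ f l q * (D a g * D b h) := by
    refine Finset.sum_congr rfl fun l _ => Finset.sum_congr rfl fun q _ => ?_
    rw [Finset.sum_comm]
    exact Finset.sum_congr rfl fun a _ => Finset.sum_congr rfl fun b _ => by
      rw [Gm_symm B D Φ hBB]
  have h5 : ∀ l q a b, D l (Gm B D Φ q a b) * b2 B D Φ f l q * D a (D b (g * h))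
      = D l (Gm B D Φ q a b) * b2 B D Φ f l q * D a (D b g) * h
      + g * (D l (Gm B D Φ q a b) * b2 B D Φ f l q * D a (D b h))
      + D l (Gm B D Φ q a b) * b2 B D Φ f l q * (D a g * D b h)
      + D l (Gm B D Φ q a b) * b2 B D Φ f l q * (D b g * D a h) := by
    intro l q a b
    simp only [Derivation.leibniz, smul_eq_mul, map_add]
    ring
  rw [congr4 h5]
  simp only [Finset.sum_add_distrib]
  rw [h1]
  simp only [← Finset.mul_sum, ← Finset.sum_mul]
  ring

include hBB in
lemma R3 (f g h : A) :
    ∑ l, ∑ q, b2 B D Φ f l q * D l (D q (c1 B D g h)) =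
    ∑ l, ∑ q, ∑ t, b2 B D Φ f l q * D l (D q (B t g)) * D t h
    + 2 * ∑ l, ∑ q, ∑ t, b2 B D Φ f l q * D l (B t g) * D q (D t h)
    + ∑ l, ∑ q, ∑ t, b2 B D Φ f l q * B t g * D l (D q (D t h)) := by
  have h1 : ∑ l, ∑ q, ∑ t, b2 B D Φ f l q * D q (B t g) * D l (D t h)
      = ∑ l, ∑ q, ∑ t, b2 B D Φ f l q * D l (B t g) * D q (D t h) := by
    rw [s213]; exact congr3 fun l q t => by rw [b2_symm B D Φ hBB]
  have h5 : ∀ l q, b2 B D Φ f l q * D l (D q (c1 B D g h))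
      = ∑ t, b2 B D Φ f l q * D l (D q (B t g)) * D t h
      + ∑ t, b2 B D Φ f l q * D l (B t g) * D q (D t h)
      + ∑ t, b2 B D Φ f l q * D q (B t g) * D l (D t h)
      + ∑ t, b2 B D Φ f l q * B t g * D l (D q (D t h)) := by
    intro l q
    simp only [c1, Derivation.leibniz, smul_eq_mul, map_add, map_sum, Finset.mul_sum,
      ← Finset.sum_add_distrib]
    exact Finset.sum_congr rfl fun t _ => by ring
  simp only [h5, Finset.sum_add_distrib]
  rw [h1]; ring

lemma R4 (f g h : A) :
    ∑ l, B l f * D l (∑ q, ∑ t, b2 B D Φ g q t * D q (D t h)) =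
    ∑ l, ∑ q, ∑ t, B l f * D l (b2 B D Φ g q t) * D q (D t h)
    + ∑ l, ∑ q, ∑ t, B l f * b2 B D Φ g q t * D l (D q (D t h)) := by
  simp only [Derivation.leibniz, smul_eq_mul, map_sum, Finset.mul_sum, ← Finset.sum_add_distrib]
  exact congr3 fun l q t => by ring

lemma assoc1 (f g h : A) :
    c1 B D (f * g) h + c1 B D f g * h = c1 B D f (g * h) + f * c1 B D g h := by
  simp only [c1, Derivation.leibniz, smul_eq_mul, Finset.sum_mul, Finset.mul_sum,
    ← Finset.sum_add_distrib]
  exact Finset.sum_congr rfl fun t _ => by ring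

include hBB hDD hBD in
lemma assoc2 (f g h : A) :
    c2 B D Φ (f * g) h + c1 B D (c1 B D f g) h + c2 B D Φ f g * h =
    c2 B D Φ f (g * h) + c1 B D f (c1 B D g h) + f * c2 B D Φ g h := by
  have e1 : ∑ l, ∑ q, b2 B D Φ (f * g) l q * D l (D q h)
      = (∑ l, ∑ q, b2 B D Φ f l q * D l (D q h)) * g
      + ∑ l, ∑ q, B l f * B q g * D l (D q h) + ∑ l, ∑ q, B q f * B l g * D l (D q h)
      + f * ∑ l, ∑ q, b2 B D Φ g l q * D l (D q h) := by
    simp only [Finset.sum_mul, Finset.mul_sum, ← Finset.sum_add_distrib, b2_mul]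
    exact Finset.sum_congr rfl fun l _ => Finset.sum_congr rfl fun q _ => by ring
  have e2 : ∑ l, ∑ q, b2 B D Φ f l q * D l (D q (g * h))
      = (∑ l, ∑ q, b2 B D Φ f l q * D l (D q g)) * h
      + ∑ l, ∑ q, b2 B D Φ f l q * D l g * D q h + ∑ l, ∑ q, b2 B D Φ f l q * D q g * D l h
      + g * ∑ l, ∑ q, b2 B D Φ f l q * D l (D q h) := by
    simp only [Finset.sum_mul, Finset.mul_sum, ← Finset.sum_add_distrib,
      Derivation.leibniz, smul_eq_mul, map_add]
    exact Finset.sum_congr rfl fun l _ => Finset.sum_congr rfl fun q _ => by ring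
  have e3 : ∑ l, ∑ q, b2 B D Φ f l q * D q g * D l h
      = ∑ l, ∑ q, b2 B D Φ f l q * D l g * D q h := by
    rw [Finset.sum_comm]
    exact Finset.sum_congr rfl fun l _ => Finset.sum_congr rfl fun q _ => by
      rw [b2_symm B D Φ hBB]
  have e4 : ∑ l, ∑ q, B q f * B l g * D l (D q h) = ∑ l, ∑ q, B l f * B q g * D l (D q h) := by
    rw [Finset.sum_comm]
    exact Finset.sum_congr rfl fun l _ => Finset.sum_congr rfl fun q _ => by
      rw [hDD q l]
  have e5 : c1 B D (c1 B D f g) h = ∑ l, ∑ q, b2 B D Φ f l q * D l g * D q h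
      + ∑ l, ∑ q, B l f * D l (B q g) * D q h := by
    rw [c1]
    simp only [B_c1 B D Φ hBB hBD, add_mul, Finset.sum_mul, Finset.sum_add_distrib]
    rw [Finset.sum_comm, Finset.sum_comm (f := fun q l => B l f * D l (B q g) * D q h)]
  have e6 : c1 B D f (c1 B D g h) = ∑ l, ∑ q, B l f * D l (B q g) * D q h
      + ∑ l, ∑ q, B l f * B q g * D l (D q h) := by
    simp only [c1, Derivation.leibniz, smul_eq_mul, map_sum, Finset.mul_sum,
      ← Finset.sum_add_distrib]
    exact Finset.sum_congr rfl fun l _ => Finset.sum_congr rfl fun q _ => by ring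
  have hc : 2 * algebraMap ℂ A (1 / 2) = 1 := by
    rw [← map_ofNat (algebraMap ℂ A) 2, ← map_mul]; norm_num
  rw [e5, e6]
  simp only [c2, Algebra.smul_def]
  rw [e1, e2, e3, e4]
  linear_combination (∑ l, ∑ q, B l f * B q g * D l (D q h)
    - ∑ l, ∑ q, b2 B D Φ f l q * D l g * D q h) * hc

include hBB hDD hBD in
lemma assoc3 (f g h : A) :
    c3 B D Φ (f * g) h + c2 B D Φ (c1 B D f g) h + c1 B D (c2 B D Φ f g) h + c3 B D Φ f g * h =
    c3 B D Φ f (g * h) + c2 B D Φ f (c1 B D g h) + c1 B D f (c2 B D Φ g h) + f * c3 B D Φ g h := by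
  have k1 : c1 B D (c2 B D Φ f g) h = (1 / 2 : ℂ) • (∑ t, B t (∑ l, ∑ q, b2 B D Φ f l q * D l (D q g)) * D t h) := by
    simp only [c1, c2, Derivation.map_smul, smul_mul_assoc]
    rw [Finset.smul_sum]
  have k2 : c1 B D f (c2 B D Φ g h) = (1 / 2 : ℂ) • (∑ l, B l f * D l (∑ q, ∑ t, b2 B D Φ g q t * D q (D t h))) := by
    simp only [c1, c2, Derivation.map_smul, mul_smul_comm]
    rw [Finset.smul_sum]
  have h6 : algebraMap ℂ A (1 / 2) = 3 * algebraMap ℂ A (1 / 6) := by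
    rw [← map_ofNat (algebraMap ℂ A) 3, ← map_mul]; norm_num
  have h4 : algebraMap ℂ A (1 / 2) = 2 * algebraMap ℂ A (1 / 4) := by
    rw [← map_ofNat (algebraMap ℂ A) 2, ← map_mul]; norm_num
  rw [k1, k2]
  simp only [c2, c3, Algebra.smul_def]
  rw [L1 B D Φ hBB hDD, L2 B D Φ hDD, L3 B D Φ hBB hDD hBD, L4 B D Φ hBB hBD,
    R1 B D Φ hBB hDD hBD, R2 B D Φ hBB hDD, R3 B D Φ hBB, R4 B D Φ]
  generalize algebraMap ℂ A (1 / 2) = c at *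
  linear_combination (exp := 1)
    (∑ l, ∑ q, ∑ t, b3 B D Φ f l q t * D l (D q g) * D t h
     + ∑ l, ∑ q, ∑ t, b3 B D Φ f l q t * D l g * D q (D t h)
     - ∑ l, ∑ q, ∑ t, b2 B D Φ f l q * B t g * D l (D q (D t h))
     - ∑ l, ∑ q, ∑ t, B l f * b2 B D Φ g q t * D l (D q (D t h))) * h6
    + (∑ l, ∑ q, ∑ a, ∑ b, D l (Gm B D Φ q a b) * (B l f * B q g) * D a (D b h)
     - ∑ l, ∑ q, ∑ a, ∑ b, D l (Gm B D Φ q a b) * b2 B D Φ f l q * (D a g * D b h)) * h4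

end stage2

section stage1
variable {A ι : Type*} [CommRing A] [Algebra ℂ A] [Fintype ι] [DecidableEq ι]
variable (P B : ι → Derivation ℂ A A) (Φ : A) (G : ι → ι → A)

/-- raised holomorphic derivations -/
def Dr (l : ι) : Derivation ℂ A A := ∑ k, G l k • P k

lemma Dr_apply (l : ι) (a : A) : Dr P G l a = ∑ k, G l k * P k a := by
  have : ∀ s : Finset ι, (∑ k ∈ s, G l k • P k) a = ∑ k ∈ s, G l k * P k a := by
    classical
    intro s
    induction s using Finset.induction_on with
    | empty => simp
    | insert i s hi ih => rw [Finset.sum_insert hi, Finset.sum_insert hi, ← ih]; rfl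
  exact this _

/-- algebraic version of `GamH` -/
def aGamH (s k p : ι) : A := ∑ t, P k (P p (B t Φ)) * G t s
/-- algebraic version of `GamB` -/
def aGamB (t l q : ι) : A := ∑ s, G t s * P s (B q (B l Φ))
/-- algebraic version of `cdH2` -/
def aH2 (ψ : A) (k p : ι) : A := P p (P k ψ) - ∑ s, aGamH P B Φ G s p k * P s ψ
/-- algebraic version of `cdH3` -/
def aH3 (ψ : A) (k p s : ι) : A := P s (aH2 P B Φ G ψ k p)
  - ∑ a, aGamH P B Φ G a s k * aH2 P B Φ G ψ a p - ∑ a, aGamH P B Φ G a s p * aH2 P B Φ G ψ k a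
/-- algebraic version of `cdB2` -/
def aB2 (φ : A) (l q : ι) : A := B q (B l φ) - ∑ t, aGamB P B Φ G t q l * B t φ
/-- algebraic version of `cdB3` -/
def aB3 (φ : A) (l q t : ι) : A := B t (aB2 P B Φ G φ l q)
  - ∑ a, aGamB P B Φ G a t l * aB2 P B Φ G φ a q - ∑ a, aGamB P B Φ G a t q * aB2 P B Φ G φ l a
/-- algebraic version of `Rcur` -/
def aR (q p k l : ι) : A := P k (B l (G q p))
  - ∑ m, ∑ m', B l (G q m) * P k (G m' p) * P m (B m' Φ)
/-- algebraic version of `Rup4` -/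
def aRup (l k q p : ι) : A := ∑ a, ∑ b, G l a * G b k * aR P B Φ G q p a b
/-- algebraic version of `C1op` -/
def aC1 (φ ψ : A) : A := ∑ l, ∑ k, G l k * B l φ * P k ψ
/-- algebraic version of `C2op` -/
def aC2 (φ ψ : A) : A := (1 / 2 : ℂ) • ∑ l, ∑ k, ∑ q, ∑ p,
    G l k * G q p * aB2 P B Φ G φ l q * aH2 P B Φ G ψ k p
/-- the biderivation part -/
def aS (φ ψ : A) : A := ∑ l, ∑ k, (∑ m, ∑ m', ∑ p, ∑ q,
        G m' m * aR P B Φ G l p m q * aR P B Φ G q k p m') * B l φ * P k ψ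
/-- algebraic version of `C3top` -/
def aC3 (φ ψ : A) : A :=
  (1 / 6 : ℂ) • (∑ l, ∑ k, ∑ q, ∑ p, ∑ t, ∑ s,
        G l k * G q p * G t s * aB3 P B Φ G φ l q t * aH3 P B Φ G ψ k p s)
    + (1 / 4 : ℂ) • (∑ l, ∑ k, ∑ q, ∑ p,
        aRup P B Φ G l k q p * aB2 P B Φ G φ l q * aH2 P B Φ G ψ k p)
    + (1 / 12 : ℂ) • aS P B Φ G φ ψ

variable (hPP : ∀ k l a, P k (P l a) = P l (P k a)) (hBB : ∀ k l a, B k (B l a) = B l (B k a))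
  (hBP : ∀ k l a, B k (P l a) = P l (B k a))
  (h1 : ∀ l q, ∑ k, G l k * P k (B q Φ) = if l = q then 1 else 0)
  (h2 : ∀ p k, ∑ l, P p (B l Φ) * G l k = if p = k then 1 else 0)

include h1 h2 in
lemma E_G (E : Derivation ℂ A A) (p m : ι) :
    E (G p m) = - ∑ a, ∑ b, G p a * E (P a (B b Φ)) * G b m := by
  have e1 : ∀ b, ∑ a, E (G p a) * P a (B b Φ) = - ∑ a, G p a * E (P a (B b Φ)) := by
    intro b
    have := congrArg E (h1 p b)
    rw [map_sum, apply_ite E, map_zero, Derivation.map_one_eq_zero, ite_self] at this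
    simp only [Derivation.leibniz, smul_eq_mul, Finset.sum_add_distrib] at this
    rw [eq_neg_iff_add_eq_zero, ← this, add_comm]
    simp only [mul_comm]
  have e2 : ∑ a, E (G p a) * ∑ b, P a (B b Φ) * G b m = E (G p m) := by
    simp [h2]
  rw [← e2]
  simp only [Finset.mul_sum]
  rw [Finset.sum_comm, Finset.sum_comm (f := fun a b => G p a * E (P a (B b Φ)) * G b m),
    ← Finset.sum_neg_distrib]
  refine Finset.sum_congr rfl fun b _ => ?_
  rw [← Finset.sum_mul, ← neg_mul, ← e1, Finset.sum_mul]
  exact Finset.sum_congr rfl fun b _ => by ring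

include h1 h2 in
lemma P_G (k p m : ι) : P k (G p m) = - ∑ a, G p a * aGamH P B Φ G m k a := by
  rw [E_G P B Φ G h1 h2]
  simp only [aGamH, Finset.mul_sum, mul_assoc]

include h1 h2 hBB hBP in
lemma B_G (q l m : ι) : B q (G l m) = - ∑ b, Gm B (Dr P G) Φ l b q * G b m := by
  rw [E_G P B Φ G h1 h2, Finset.sum_comm]
  simp only [Gm, Dr_apply, Finset.sum_mul, hBP, hBB q]

include h1 h2 in
lemma DDH (ψ : A) (l q : ι) : Dr P G l (Dr P G q ψ) =
    ∑ k, ∑ p, G l k * G q p * aH2 P B Φ G ψ p k := by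
  rw [Dr_apply]
  refine Finset.sum_congr rfl fun k _ => ?_
  simp only [Dr_apply, map_sum, Derivation.leibniz, smul_eq_mul, P_G P B Φ G h1 h2, aH2, mul_sub,
    Finset.sum_add_distrib, Finset.sum_sub_distrib, mul_add, Finset.mul_sum, mul_neg,
    Finset.sum_neg_distrib]
  rw [Finset.sum_comm (f := fun p s => G l k * G q p * (aGamH P B Φ G s k p * P s ψ))]
  rw [sub_eq_add_neg]
  congr 1
  · exact Finset.sum_congr rfl fun b _ => by ring
  · congr 1
    exact Finset.sum_congr rfl fun a _ => Finset.sum_congr rfl fun b _ => by ring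

include hPP in
lemma aH2_symm (ψ : A) (k p : ι) : aH2 P B Φ G ψ k p = aH2 P B Φ G ψ p k := by
  simp only [aH2, aGamH, hPP k p]

include h1 h2 hPP in
lemma Dr_comm (l q : ι) (ψ : A) : Dr P G l (Dr P G q ψ) = Dr P G q (Dr P G l ψ) := by
  rw [DDH P B Φ G h1 h2, DDH P B Φ G h1 h2, Finset.sum_comm]
  exact Finset.sum_congr rfl fun a _ => Finset.sum_congr rfl fun b _ => by
    rw [aH2_symm P B Φ G hPP]; ring

include h1 h2 hBB hBP in
lemma B_Dr (q l : ι) (a : A) : B q (Dr P G l a) =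
    Dr P G l (B q a) - ∑ b, Gm B (Dr P G) Φ l b q * Dr P G b a := by
  simp only [Dr_apply _ _ _ a, Dr_apply _ _ _ (B q a), map_sum, Derivation.leibniz, smul_eq_mul,
    B_G P B Φ G hBB hBP h1 h2, hBP, Finset.sum_add_distrib, sub_eq_add_neg]
  congr 1
  simp only [Finset.mul_sum, mul_neg, Finset.sum_neg_distrib]
  rw [Finset.sum_comm]
  congr 1
  exact Finset.sum_congr rfl fun a _ => Finset.sum_congr rfl fun b _ => by ring

include h1 h2 hPP in
lemma DDDH (ψ : A) (l q t : ι) : Dr P G l (Dr P G q (Dr P G t ψ)) =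
    ∑ k, ∑ p, ∑ s, G l k * G q p * G t s * aH3 P B Φ G ψ k p s := by
  have hD := Dr_comm P B Φ G hPP h1 h2
  rw [hD q t, hD l t, DDH P B Φ G h1 h2 ψ l q, Dr_apply]
  have e : ∀ s, P s (∑ k, ∑ p, G l k * G q p * aH2 P B Φ G ψ p k)
     = ∑ k, ∑ p, G l k * G q p * aH3 P B Φ G ψ k p s := by
    intro s
    have e1 : ∑ k, ∑ p, G l k * G q p * ∑ a, aGamH P B Φ G a s k * aH2 P B Φ G ψ a p
        = - ∑ k, ∑ p, P s (G l k) * G q p * aH2 P B Φ G ψ k p := by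
      simp only [P_G P B Φ G h1 h2, neg_mul, Finset.sum_neg_distrib, neg_neg, Finset.sum_mul,
        Finset.mul_sum]
      have : ∀ F : ι → ι → ι → A, ∑ k, ∑ p, ∑ a, F k p a = ∑ a, ∑ p, ∑ k, F k p a := by
        intro F; rw [s132, s213, s132]
      rw [this]
      exact congr3 fun _ _ _ => by ring
    have e2 : ∑ k, ∑ p, G l k * G q p * ∑ a, aGamH P B Φ G a s p * aH2 P B Φ G ψ k a
        = - ∑ k, ∑ p, G l k * P s (G q p) * aH2 P B Φ G ψ k p := by
      simp only [P_G P B Φ G h1 h2, neg_mul, mul_neg, Finset.sum_neg_distrib, neg_neg,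
        Finset.sum_mul, Finset.mul_sum]
      rw [s132]
      exact congr3 fun _ _ _ => by ring
    simp only [aH3, mul_sub, Finset.sum_sub_distrib]
    rw [e1, e2, sub_neg_eq_add, sub_neg_eq_add]
    simp only [map_sum, Derivation.leibniz, smul_eq_mul, ← Finset.sum_add_distrib]
    exact Finset.sum_congr rfl fun a _ => Finset.sum_congr rfl fun b _ => by
      rw [aH2_symm P B Φ G hPP ψ a b]; ring
  simp only [e, Finset.mul_sum]
  rw [s213, s132]
  exact congr3 fun _ _ _ => by ring


include hBB in
lemma aGamB_eq (t l q : ι) : aGamB P B Φ G t l q = Gm B (Dr P G) Φ t l q := by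
  simp only [aGamB, Gm, Dr_apply, hBB q l]

include hBB in
lemma aB2_eq (φ : A) (l q : ι) : aB2 P B Φ G φ l q = b2 B (Dr P G) Φ φ l q := by
  simp only [aB2, b2, aGamB_eq P B Φ G hBB]

include hBB in
lemma aB3_eq (φ : A) (l q t : ι) : aB3 P B Φ G φ l q t = b3 B (Dr P G) Φ φ l q t := by
  simp only [aB3, b3, aGamB_eq P B Φ G hBB, aB2_eq P B Φ G hBB]

lemma aC1_eq (φ ψ : A) : aC1 P B G φ ψ = c1 B (Dr P G) φ ψ := by
  simp only [aC1, c1, Dr_apply, Finset.mul_sum]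
  exact Finset.sum_congr rfl fun a _ => Finset.sum_congr rfl fun b _ => by ring

include hBB hPP h1 h2 in
lemma aC2_eq (φ ψ : A) : aC2 P B Φ G φ ψ = c2 B (Dr P G) Φ φ ψ := by
  simp only [aC2, c2, DDH P B Φ G h1 h2, aB2_eq P B Φ G hBB, Finset.mul_sum]
  congr 1
  refine Finset.sum_congr rfl fun l _ => ?_
  rw [Finset.sum_comm]
  exact congr3 fun q k p => by rw [aH2_symm P B Φ G hPP ψ p k]; ring

include hBB hBP h1 h2 in
lemma aR_eq (q p k l : ι) : aR P B Φ G q p k l = - ∑ b, P k (Gm B (Dr P G) Φ q b l) * G b p := by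
  have e : ∑ m, ∑ m', B l (G q m) * P k (G m' p) * P m (B m' Φ)
      = - ∑ b, Gm B (Dr P G) Φ q b l * P k (G b p) := by
    have e1 : ∀ b, P k (G b p) = ∑ m', (∑ m, G b m * P m (B m' Φ)) * P k (G m' p) := by
      intro b; simp [h1]
    simp only [B_G P B Φ G hBB hBP h1 h2, neg_mul, Finset.sum_neg_distrib]
    congr 1
    rw [Finset.sum_congr rfl fun b _ => congrArg (Gm B (Dr P G) Φ q b l * ·) (e1 b)]
    simp only [Finset.sum_mul, Finset.mul_sum]
    rw [s132, s213, s132]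
    exact congr3 fun _ _ _ => by ring
  rw [aR, e, B_G P B Φ G hBB hBP h1 h2]
  simp only [map_neg, map_sum, Derivation.leibniz, smul_eq_mul, Finset.sum_add_distrib]
  simp only [mul_comm (G _ p)]
  ring

include hBB hBP h1 h2 in
lemma aRup_eq (l k q p : ι) : aRup P B Φ G l k q p =
    - ∑ a, ∑ b, Dr P G l (Gm B (Dr P G) Φ q a b) * G b k * G a p := by
  simp only [aRup, aR_eq P B Φ G hBB hBP h1 h2, Dr_apply _ _ l, mul_neg, Finset.sum_neg_distrib,
    Finset.mul_sum, Finset.sum_mul]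
  congr 1
  rw [s132, s213, s132]
  exact congr3 fun _ _ _ => by ring

include hBB hBP hPP h1 h2 in
lemma aC3_eq (φ ψ : A) : aC3 P B Φ G φ ψ = c3 B (Dr P G) Φ φ ψ
    + (1 / 12 : ℂ) • aS P B Φ G φ ψ := by
  rw [aC3, c3, sub_eq_add_neg, ← smul_neg]
  congr 2
  · congr 1
    simp only [DDDH P B Φ G hPP h1 h2, aB3_eq P B Φ G hBB, Finset.mul_sum]
    refine Finset.sum_congr rfl fun l _ => ?_
    rw [Finset.sum_comm]
    refine Finset.sum_congr rfl fun q _ => ?_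
    have : ∀ F : ι → ι → ι → ι → A, ∑ k, ∑ p, ∑ t, ∑ s, F k p t s = ∑ t, ∑ k, ∑ p, ∑ s, F k p t s := by
      intro F; rw [s132, s213]
    rw [this]
    exact congr4 fun _ _ _ _ => by ring
  · congr 1
    simp only [aB2_eq P B Φ G hBB, aRup_eq P B Φ G hBB hBP h1 h2, neg_mul, Finset.sum_neg_distrib]
    refine congrArg Neg.neg ?_
    refine Finset.sum_congr rfl fun l _ => ?_
    rw [Finset.sum_comm]
    refine Finset.sum_congr rfl fun q _ => ?_
    simp only [DDH P B Φ G h1 h2, Finset.mul_sum, Finset.sum_mul]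
    have : ∀ F : ι → ι → ι → ι → A, ∑ k, ∑ p, ∑ a, ∑ b, F k p a b = ∑ a, ∑ b, ∑ p, ∑ k, F k p a b := by
      intro F
      rw [s132, s213]
      refine Finset.sum_congr rfl fun a _ => ?_
      rw [s132, s213, s132]
    rw [this]
    exact congr4 fun _ _ _ _ => by ring

lemma aS_assoc (f g h : A) : aS P B Φ G (f * g) h + aS P B Φ G f g * h
    = aS P B Φ G f (g * h) + f * aS P B Φ G g h := by
  unfold aS
  generalize (fun l k => ∑ m, ∑ m', ∑ p, ∑ q,
        G m' m * aR P B Φ G l p m q * aR P B Φ G q k p m') = S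
  simp only [Derivation.leibniz, smul_eq_mul]
  simp only [Finset.sum_mul _ _ h, Finset.mul_sum _ _ f, ← Finset.sum_add_distrib]
  exact Finset.sum_congr rfl fun a _ => Finset.sum_congr rfl fun b _ => by ring

include hBB hBP hPP h1 h2 in
lemma aAssoc3 (f g h : A) :
    f * aC3 P B Φ G g h + aC1 P B G f (aC2 P B Φ G g h) + aC2 P B Φ G f (aC1 P B G g h)
     + aC3 P B Φ G f (g * h) =
    aC3 P B Φ G f g * h + aC1 P B G (aC2 P B Φ G f g) h + aC2 P B Φ G (aC1 P B G f g) h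
     + aC3 P B Φ G (f * g) h := by
  simp only [aC3_eq P B Φ G hPP hBB hBP h1 h2, aC2_eq P B Φ G hPP hBB h1 h2, aC1_eq,
    Algebra.smul_def]
  linear_combination - assoc3 B (Dr P G) Φ hBB (Dr_comm P B Φ G hPP h1 h2)
    (B_Dr P B Φ G hBB hBP h1 h2) f g h - algebraMap ℂ A (1 / 12) * aS_assoc P B Φ G f g h

include hBB hBP hPP h1 h2 in
lemma aAssoc2 (f g h : A) :
    f * aC2 P B Φ G g h + aC1 P B G f (aC1 P B G g h) + aC2 P B Φ G f (g * h) =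
    aC2 P B Φ G f g * h + aC1 P B G (aC1 P B G f g) h + aC2 P B Φ G (f * g) h := by
  simp only [aC2_eq P B Φ G hPP hBB h1 h2, aC1_eq]
  linear_combination - assoc2 B (Dr P G) Φ hBB (Dr_comm P B Φ G hPP h1 h2)
    (B_Dr P B Φ G hBB hBP h1 h2) f g h

lemma aAssoc1 (f g h : A) :
    f * aC1 P B G g h + aC1 P B G f (g * h) = aC1 P B G f g * h + aC1 P B G (f * g) h := by
  simp only [aC1_eq]
  linear_combination - assoc1 B (Dr P G) f g h

end stage1
end KStar

namespace KStar
section analysis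
variable {n : ℕ} {U : Set (Fin n → ℂ)}

/-- common form of the Wirtinger derivatives -/
def W (c : ℂ) (k : Fin n) (f : (Fin n → ℂ) → ℂ) : (Fin n → ℂ) → ℂ :=
  fun z => (1 / 2 : ℂ) *
    (fderiv ℝ f z (ebasis n k) + c * fderiv ℝ f z (Complex.I • ebasis n k))

lemma wdP_eq (k : Fin n) (f : (Fin n → ℂ) → ℂ) : wdP n k f = W (-Complex.I) k f := by
  funext z; simp only [wdP, W]; ring

lemma wdB_eq (k : Fin n) (f : (Fin n → ℂ) → ℂ) : wdB n k f = W Complex.I k f := rfl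

lemma W_congr (hU : IsOpen U) (c : ℂ) (k : Fin n) {f g : (Fin n → ℂ) → ℂ}
    (h : ∀ z ∈ U, f z = g z) : ∀ z ∈ U, W c k f z = W c k g z := by
  intro z hz
  have : f =ᶠ[nhds z] g := Filter.eventuallyEq_of_mem (hU.mem_nhds hz) h
  simp only [W, this.fderiv_eq]

lemma dd_smooth (hU : IsOpen U) {f : (Fin n → ℂ) → ℂ} (hf : ContDiffOn ℝ (⊤ : ℕ∞) f U)
    (v : Fin n → ℂ) : ContDiffOn ℝ (⊤ : ℕ∞) (fun z => fderiv ℝ f z v) U :=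
  (hf.fderiv_of_isOpen hU (m := (⊤ : ℕ∞)) (by simp)).clm_apply contDiffOn_const

lemma W_smooth (hU : IsOpen U) (c : ℂ) (k : Fin n) {f : (Fin n → ℂ) → ℂ}
    (hf : ContDiffOn ℝ (⊤ : ℕ∞) f U) : ContDiffOn ℝ (⊤ : ℕ∞) (W c k f) U :=
  contDiffOn_const.mul ((dd_smooth hU hf _).add (contDiffOn_const.mul (dd_smooth hU hf _)))

lemma sm_diff (hU : IsOpen U) {f : (Fin n → ℂ) → ℂ}
    (hf : ContDiffOn ℝ (⊤ : ℕ∞) f U) {z : Fin n → ℂ} (hz : z ∈ U) : DifferentiableAt ℝ f z :=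
  (hf.contDiffAt (hU.mem_nhds hz)).differentiableAt (by simp)

lemma dd_comm (hU : IsOpen U) {f : (Fin n → ℂ) → ℂ} (hf : ContDiffOn ℝ (⊤ : ℕ∞) f U)
    (v w : Fin n → ℂ) {z : Fin n → ℂ} (hz : z ∈ U) :
    fderiv ℝ (fun y => fderiv ℝ f y v) z w = fderiv ℝ (fun y => fderiv ℝ f y w) z v := by
  have hd : DifferentiableAt ℝ (fderiv ℝ f) z :=
    ((hf.fderiv_of_isOpen hU (m := (⊤ : ℕ∞)) (by simp)).contDiffAt
      (hU.mem_nhds hz)).differentiableAt (by simp)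
  have hs : IsSymmSndFDerivAt ℝ f z :=
    (hf.contDiffAt (hU.mem_nhds hz)).isSymmSndFDerivAt (by
      simp only [minSmoothness_of_isRCLikeNormedField]
      exact WithTop.coe_le_coe.2 (le_top : (2 : ℕ∞) ≤ ⊤))
  have e : ∀ v w : Fin n → ℂ, fderiv ℝ (fun y => fderiv ℝ f y v) z w = fderiv ℝ (fderiv ℝ f) z w v := by
    intro v w
    rw [fderiv_clm_apply hd (differentiableAt_const v)]
    simp
  rw [e, e, hs]

lemma W_comm (hU : IsOpen U) (c d : ℂ) (k l : Fin n) {f : (Fin n → ℂ) → ℂ}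
    (hf : ContDiffOn ℝ (⊤ : ℕ∞) f U) {z : Fin n → ℂ} (hz : z ∈ U) :
    W c k (W d l f) z = W d l (W c k f) z := by
  have e : ∀ (d : ℂ) (l : Fin n) (v : Fin n → ℂ), fderiv ℝ (W d l f) z v =
      (1 / 2 : ℂ) * (fderiv ℝ (fun y => fderiv ℝ f y (ebasis n l)) z v
        + d * fderiv ℝ (fun y => fderiv ℝ f y (Complex.I • ebasis n l)) z v) := by
    intro d l v
    have h1 := sm_diff hU (dd_smooth hU hf (ebasis n l)) hz
    have h2 := sm_diff hU (dd_smooth hU hf (Complex.I • ebasis n l)) hz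
    unfold W
    rw [fderiv_const_mul (h1.fun_add (h2.const_mul d)), fderiv_fun_add h1 (h2.const_mul d),
      fderiv_const_mul h2]
    simp only [add_apply, smul_apply, smul_eq_mul]
  have e1 := dd_comm hU hf (ebasis n l) (ebasis n k) hz
  have e2 := dd_comm hU hf (ebasis n l) (Complex.I • ebasis n k) hz
  have e3 := dd_comm hU hf (Complex.I • ebasis n l) (ebasis n k) hz
  have e4 := dd_comm hU hf (Complex.I • ebasis n l) (Complex.I • ebasis n k) hz
  rw [W, W, e, e, e, e, e1, e2, e3, e4]
  ring

lemma W_add (hU : IsOpen U) (c : ℂ) (k : Fin n) {f g : (Fin n → ℂ) → ℂ}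
    (hf : ContDiffOn ℝ (⊤ : ℕ∞) f U) (hg : ContDiffOn ℝ (⊤ : ℕ∞) g U) {z : Fin n → ℂ} (hz : z ∈ U) :
    W c k (fun z => f z + g z) z = W c k f z + W c k g z := by
  unfold W
  rw [fderiv_fun_add (sm_diff hU hf hz) (sm_diff hU hg hz)]
  simp only [add_apply]
  ring

lemma W_smul (hU : IsOpen U) (c : ℂ) (k : Fin n) (a : ℂ) {f : (Fin n → ℂ) → ℂ}
    (hf : ContDiffOn ℝ (⊤ : ℕ∞) f U) {z : Fin n → ℂ} (hz : z ∈ U) :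
    W c k (fun z => a * f z) z = a * W c k f z := by
  unfold W
  rw [fderiv_const_mul (sm_diff hU hf hz)]
  simp only [smul_apply, smul_eq_mul]
  ring

lemma W_mul (hU : IsOpen U) (c : ℂ) (k : Fin n) {f g : (Fin n → ℂ) → ℂ}
    (hf : ContDiffOn ℝ (⊤ : ℕ∞) f U) (hg : ContDiffOn ℝ (⊤ : ℕ∞) g U) {z : Fin n → ℂ} (hz : z ∈ U) :
    W c k (fun z => f z * g z) z = f z * W c k g z + g z * W c k f z := by
  unfold W
  rw [fderiv_fun_mul (sm_diff hU hf hz) (sm_diff hU hg hz)]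
  simp only [add_apply, smul_apply, smul_eq_mul]
  ring

/-- The algebra of smooth functions on `U`. -/
def Sm (U : Set (Fin n → ℂ)) : Subalgebra ℂ (U → ℂ) where
  carrier := {a | ∃ F : (Fin n → ℂ) → ℂ, ContDiffOn ℝ (⊤ : ℕ∞) F U ∧ ∀ z : U, F z = a z}
  mul_mem' := by
    rintro a b ⟨F, hF, h⟩ ⟨F', hF', h'⟩
    exact ⟨fun z => F z * F' z, hF.mul hF', fun z => by simp [h, h']⟩
  add_mem' := by
    rintro a b ⟨F, hF, h⟩ ⟨F', hF', h'⟩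
    exact ⟨fun z => F z + F' z, hF.add hF', fun z => by simp [h, h']⟩
  algebraMap_mem' := fun c => ⟨fun _ => c, contDiffOn_const, fun _ => rfl⟩

/-- `F` restricts to `a` on `U`. -/
def Rep (F : (Fin n → ℂ) → ℂ) (a : Sm U) : Prop := ∀ z : U, F z = a.1 z

/-- a chosen extension -/
def rp (a : Sm U) : (Fin n → ℂ) → ℂ := a.2.choose

lemma rp_smooth (a : Sm U) : ContDiffOn ℝ (⊤ : ℕ∞) (rp a) U := a.2.choose_spec.1

lemma rp_rep (a : Sm U) : Rep (rp a) a := a.2.choose_spec.2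

/-- the underlying function of the derivation -/
def dW (hU : IsOpen U) (c : ℂ) (k : Fin n) (a : Sm U) : Sm U :=
  ⟨fun z => W c k (rp a) z, W c k (rp a), W_smooth hU c k (rp_smooth a), fun _ => rfl⟩

lemma Rep.dW (hU : IsOpen U) (c : ℂ) (k : Fin n) {F : (Fin n → ℂ) → ℂ} {a : Sm U} (h : Rep F a) :
    Rep (W c k F) (dW hU c k a) := by
  intro z
  exact W_congr hU c k (fun y hy => (h ⟨y, hy⟩).trans (rp_rep a ⟨y, hy⟩).symm) z z.2

lemma Rep.unique {F : (Fin n → ℂ) → ℂ} {a b : Sm U} (h : Rep F a) (h' : Rep F b) : a = b :=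
  Subtype.ext (funext fun z => (h z).symm.trans (h' z))

lemma Rep.congr {F G : (Fin n → ℂ) → ℂ} {a : Sm U} (h : Rep F a) (h' : ∀ z ∈ U, G z = F z) :
    Rep G a := fun z => (h' z z.2).trans (h z)

lemma Rep.add {F G : (Fin n → ℂ) → ℂ} {a b : Sm U} (h : Rep F a) (h' : Rep G b) :
    Rep (fun z => F z + G z) (a + b) := fun z => congrArg₂ (· + ·) (h z) (h' z)

lemma Rep.sub {F G : (Fin n → ℂ) → ℂ} {a b : Sm U} (h : Rep F a) (h' : Rep G b) :
    Rep (fun z => F z - G z) (a - b) := fun z => congrArg₂ (· - ·) (h z) (h' z)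

lemma Rep.mul {F G : (Fin n → ℂ) → ℂ} {a b : Sm U} (h : Rep F a) (h' : Rep G b) :
    Rep (fun z => F z * G z) (a * b) := fun z => congrArg₂ (· * ·) (h z) (h' z)

lemma Rep.smul {F : (Fin n → ℂ) → ℂ} {a : Sm U} (c : ℂ) (h : Rep F a) :
    Rep (fun z => c * F z) (c • a) := fun z => congrArg (c * ·) (h z)

lemma Rep.sum {ι : Type*} [Fintype ι] {F : ι → (Fin n → ℂ) → ℂ} {a : ι → Sm U}
    (h : ∀ i, Rep (F i) (a i)) : Rep (fun z => ∑ i, F i z) (∑ i, a i) := by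
  intro z
  have : (∑ i, a i).1 = ∑ i, (a i).1 := by
    exact map_sum (Sm U).val a Finset.univ
  rw [this, Finset.sum_apply]
  exact Finset.sum_congr rfl fun i _ => h i z

lemma rep_mk {F : (Fin n → ℂ) → ℂ} (h : ContDiffOn ℝ (⊤ : ℕ∞) F U) : ∃ a : Sm U, Rep F a :=
  ⟨⟨fun z => F z, F, h, fun _ => rfl⟩, fun _ => rfl⟩

/-- the Wirtinger derivations on `Sm U` -/
def Wd (hU : IsOpen U) (c : ℂ) (k : Fin n) : Derivation ℂ (Sm U) (Sm U) :=
  Derivation.mk'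
    { toFun := dW hU c k
      map_add' := fun a b =>
        (((rp_rep a).add (rp_rep b)).dW hU c k).unique
          ((((rp_rep a).dW hU c k).add ((rp_rep b).dW hU c k)).congr
            fun z hz => W_add hU c k (rp_smooth a) (rp_smooth b) hz)
      map_smul' := fun r a =>
        (((rp_rep a).smul r).dW hU c k).unique
          ((((rp_rep a).dW hU c k).smul r).congr
            fun z hz => W_smul hU c k r (rp_smooth a) hz) }
    (fun a b =>
        (((rp_rep a).mul (rp_rep b)).dW hU c k).unique
          ((((rp_rep a).mul ((rp_rep b).dW hU c k)).add
            ((rp_rep b).mul ((rp_rep a).dW hU c k))).congr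
            fun z hz => W_mul hU c k (rp_smooth a) (rp_smooth b) hz))

lemma Rep.W (hU : IsOpen U) (c : ℂ) (k : Fin n) {F : (Fin n → ℂ) → ℂ} {a : Sm U} (h : Rep F a) :
    Rep (W c k F) (Wd hU c k a) := h.dW hU c k

lemma Wd_comm (hU : IsOpen U) (c d : ℂ) (k l : Fin n) (a : Sm U) :
    Wd hU c k (Wd hU d l a) = Wd hU d l (Wd hU c k a) :=
  (((rp_rep a).W hU d l).W hU c k).unique
    ((((rp_rep a).W hU c k).W hU d l).congr fun _ hz => W_comm hU c d k l (rp_smooth a) hz)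

/-- holomorphic derivations -/
def Pd (hU : IsOpen U) (k : Fin n) : Derivation ℂ (Sm U) (Sm U) := Wd hU (-Complex.I) k
/-- antiholomorphic derivations -/
def Bd (hU : IsOpen U) (k : Fin n) : Derivation ℂ (Sm U) (Sm U) := Wd hU Complex.I k

lemma Rep.P (hU : IsOpen U) (k : Fin n) {F : (Fin n → ℂ) → ℂ} {a : Sm U} (h : Rep F a) :
    Rep (wdP n k F) (Pd hU k a) := by rw [wdP_eq]; exact h.W hU _ k

lemma Rep.B (hU : IsOpen U) (k : Fin n) {F : (Fin n → ℂ) → ℂ} {a : Sm U} (h : Rep F a) :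
    Rep (wdB n k F) (Bd hU k a) := by rw [wdB_eq]; exact h.W hU _ k

section transfer
variable (hU : IsOpen U) (Φ : (Fin n → ℂ) → ℝ) (ginv : Fin n → Fin n → (Fin n → ℂ) → ℂ)
  (p : Sm U) (G : Fin n → Fin n → Sm U) (hp : Rep (Phic n Φ) p) (hG : ∀ l k, Rep (ginv l k) (G l k))
  {F F' : (Fin n → ℂ) → ℂ} {a a' : Sm U} (h : Rep F a) (h' : Rep F' a')

include hp in
lemma rep_gdn (k l : Fin n) : Rep (gdn n Φ k l) (Pd hU k (Bd hU l p)) := (hp.B hU l).P hU k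

include hp hG in
lemma rep_GamH (s k q : Fin n) : Rep (GamH n Φ ginv s k q) (aGamH (Pd hU) (Bd hU) p G s k q) :=
  Rep.sum fun t => ((((hp.B hU t).P hU q).P hU k)).mul (hG t s)

include hp hG in
lemma rep_GamB (t l q : Fin n) : Rep (GamB n Φ ginv t l q) (aGamB (Pd hU) (Bd hU) p G t l q) :=
  Rep.sum fun s => (hG t s).mul (((hp.B hU l).B hU q).P hU s)

include hp hG h in
lemma rep_H2 (k q : Fin n) : Rep (cdH2 n Φ ginv F k q) (aH2 (Pd hU) (Bd hU) p G a k q) :=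
  ((h.P hU k).P hU q).sub (Rep.sum fun s => (rep_GamH hU Φ ginv p G hp hG s q k).mul (h.P hU s))

include hp hG h in
lemma rep_B2 (k q : Fin n) : Rep (cdB2 n Φ ginv F k q) (aB2 (Pd hU) (Bd hU) p G a k q) :=
  ((h.B hU k).B hU q).sub (Rep.sum fun s => (rep_GamB hU Φ ginv p G hp hG s q k).mul (h.B hU s))

include hp hG h in
lemma rep_H3 (k q s : Fin n) : Rep (cdH3 n Φ ginv F k q s) (aH3 (Pd hU) (Bd hU) p G a k q s) :=
  (((rep_H2 hU Φ ginv p G hp hG h k q).P hU s).sub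
    (Rep.sum fun b => (rep_GamH hU Φ ginv p G hp hG b s k).mul (rep_H2 hU Φ ginv p G hp hG h b q))).sub
    (Rep.sum fun b => (rep_GamH hU Φ ginv p G hp hG b s q).mul (rep_H2 hU Φ ginv p G hp hG h k b))

include hp hG h in
lemma rep_B3 (k q s : Fin n) : Rep (cdB3 n Φ ginv F k q s) (aB3 (Pd hU) (Bd hU) p G a k q s) :=
  (((rep_B2 hU Φ ginv p G hp hG h k q).B hU s).sub
    (Rep.sum fun b => (rep_GamB hU Φ ginv p G hp hG b s k).mul (rep_B2 hU Φ ginv p G hp hG h b q))).sub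
    (Rep.sum fun b => (rep_GamB hU Φ ginv p G hp hG b s q).mul (rep_B2 hU Φ ginv p G hp hG h k b))

include hp hG in
lemma rep_R (q r k l : Fin n) : Rep (Rcur n Φ ginv q r k l) (aR (Pd hU) (Bd hU) p G q r k l) :=
  (((hG q r).B hU l).P hU k).sub (Rep.sum fun m => Rep.sum fun m' =>
    (((hG q m).B hU l).mul ((hG m' r).P hU k)).mul (rep_gdn hU Φ p hp m m'))

include hp hG in
lemma rep_Rup (l k q r : Fin n) : Rep (Rup4 n Φ ginv l k q r) (aRup (Pd hU) (Bd hU) p G l k q r) :=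
  Rep.sum fun b => Rep.sum fun c => ((hG l b).mul (hG c k)).mul (rep_R hU Φ ginv p G hp hG q r b c)

include hG h h' in
lemma rep_C1 : Rep (C1op n ginv F F') (aC1 (Pd hU) (Bd hU) G a a') :=
  Rep.sum fun l => Rep.sum fun k => ((hG l k).mul (h.B hU l)).mul (h'.P hU k)

include hp hG h h' in
lemma rep_C2 : Rep (C2op n Φ ginv F F') (aC2 (Pd hU) (Bd hU) p G a a') :=
  Rep.smul _ (Rep.sum fun l => Rep.sum fun k => Rep.sum fun q => Rep.sum fun r =>
    (((hG l k).mul (hG q r)).mul (rep_B2 hU Φ ginv p G hp hG h l q)).mul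
      (rep_H2 hU Φ ginv p G hp hG h' k r))

include hp hG h h' in
lemma rep_C3 : Rep (C3top n Φ ginv F F') (aC3 (Pd hU) (Bd hU) p G a a') :=
  ((Rep.smul _ (Rep.sum fun l => Rep.sum fun k => Rep.sum fun q => Rep.sum fun r =>
    Rep.sum fun t => Rep.sum fun s =>
    ((((hG l k).mul (hG q r)).mul (hG t s)).mul (rep_B3 hU Φ ginv p G hp hG h l q t)).mul
      (rep_H3 hU Φ ginv p G hp hG h' k r s))).add
  (Rep.smul _ (Rep.sum fun l => Rep.sum fun k => Rep.sum fun q => Rep.sum fun r =>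
    ((rep_Rup hU Φ ginv p G hp hG l k q r).mul (rep_B2 hU Φ ginv p G hp hG h l q)).mul
      (rep_H2 hU Φ ginv p G hp hG h' k r)))).add
  (Rep.smul _ (Rep.sum fun l => Rep.sum fun k =>
    ((Rep.sum fun m => Rep.sum fun m' => Rep.sum fun r => Rep.sum fun q =>
      ((hG m' m).mul (rep_R hU Φ ginv p G hp hG l r m q)).mul
        (rep_R hU Φ ginv p G hp hG q k r m')).mul (h.B hU l)).mul (h'.P hU k)))

end transfer
end analysis
end KStar

/-- `f ∗̃ g = fg + ν C₁(f,g) + ν² C₂(f,g) + ν³ C̃₃(f,g)` is associative up to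
the third order: for every `r ∈ {0,1,2,3}`,
`Σ_{i+j=r} Dᵢ(Dⱼ(f,g),h) = Σ_{i+j=r} Dᵢ(f,Dⱼ(g,h))` on `U`. -/
theorem stmt_1 (n : ℕ) (hn : 1 ≤ n) (U : Set (Fin n → ℂ)) (hU : IsOpen U)
    (Φ : (Fin n → ℂ) → ℝ) (hΦ : ContDiffOn ℝ (⊤ : ℕ∞) Φ U)
    (ginv : Fin n → Fin n → (Fin n → ℂ) → ℂ)
    (hginv : ∀ l k : Fin n, ContDiffOn ℝ (⊤ : ℕ∞) (ginv l k) U)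
    (hinv1 : ∀ z ∈ U, ∀ l q : Fin n,
      (∑ k, ginv l k z * gdn n Φ k q z) = if l = q then 1 else 0)
    (hinv2 : ∀ z ∈ U, ∀ p k : Fin n,
      (∑ l, gdn n Φ p l z * ginv l k z) = if p = k then 1 else 0) :
    ∀ r : ℕ, r ≤ 3 →
      ∀ f g h : (Fin n → ℂ) → ℂ,
        ContDiffOn ℝ (⊤ : ℕ∞) f U → ContDiffOn ℝ (⊤ : ℕ∞) g U → ContDiffOn ℝ (⊤ : ℕ∞) h U →
        ∀ z ∈ U,
          (∑ i ∈ Finset.range (r + 1), Dop n Φ ginv i (Dop n Φ ginv (r - i) f g) h z)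
            = ∑ i ∈ Finset.range (r + 1), Dop n Φ ginv i f (Dop n Φ ginv (r - i) g h) z := by
  intro r hr f g h hf hg hh z hz
  obtain ⟨p, hp⟩ : ∃ p : KStar.Sm U, KStar.Rep (Phic n Φ) p :=
    KStar.rep_mk (Complex.ofRealCLM.contDiff.comp_contDiffOn hΦ)
  choose G hG using fun l k => KStar.rep_mk (hginv l k)
  obtain ⟨a, ha⟩ := KStar.rep_mk hf
  obtain ⟨b, hb⟩ := KStar.rep_mk hg
  obtain ⟨c, hc⟩ := KStar.rep_mk hh
  have h1 : ∀ l q, ∑ k, G l k * KStar.Pd hU k (KStar.Bd hU q p) = if l = q then 1 else 0 := by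
    intro l q
    have e : KStar.Rep (fun z => ∑ k, ginv l k z * gdn n Φ k q z)
        (∑ k, G l k * KStar.Pd hU k (KStar.Bd hU q p)) :=
      KStar.Rep.sum fun k => (hG l k).mul (KStar.rep_gdn hU Φ p hp k q)
    refine e.unique fun w => ?_
    simp only [hinv1 w w.2]
    split_ifs <;> rfl
  have h2 : ∀ q k, ∑ l, KStar.Pd hU q (KStar.Bd hU l p) * G l k = if q = k then 1 else 0 := by
    intro q k
    have e : KStar.Rep (fun z => ∑ l, gdn n Φ q l z * ginv l k z)
        (∑ l, KStar.Pd hU q (KStar.Bd hU l p) * G l k) :=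
      KStar.Rep.sum fun l => (KStar.rep_gdn hU Φ p hp q l).mul (hG l k)
    refine e.unique fun w => ?_
    simp only [hinv2 w w.2]
    split_ifs <;> rfl
  have hPP : ∀ k l (x : KStar.Sm U), KStar.Pd hU k (KStar.Pd hU l x) = KStar.Pd hU l (KStar.Pd hU k x) :=
    fun k l x => KStar.Wd_comm hU _ _ k l x
  have hBB : ∀ k l (x : KStar.Sm U), KStar.Bd hU k (KStar.Bd hU l x) = KStar.Bd hU l (KStar.Bd hU k x) :=
    fun k l x => KStar.Wd_comm hU _ _ k l x
  have hBP : ∀ k l (x : KStar.Sm U), KStar.Bd hU k (KStar.Pd hU l x) = KStar.Pd hU l (KStar.Bd hU k x) :=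
    fun k l x => KStar.Wd_comm hU _ _ k l x
  have C1 : ∀ {F F' : (Fin n → ℂ) → ℂ} {x y : KStar.Sm U}, KStar.Rep F x → KStar.Rep F' y →
      KStar.Rep (C1op n ginv F F') (KStar.aC1 (KStar.Pd hU) (KStar.Bd hU) G x y) :=
    fun hx hy => KStar.rep_C1 hU ginv G hG hx hy
  have C2 : ∀ {F F' : (Fin n → ℂ) → ℂ} {x y : KStar.Sm U}, KStar.Rep F x → KStar.Rep F' y →
      KStar.Rep (C2op n Φ ginv F F') (KStar.aC2 (KStar.Pd hU) (KStar.Bd hU) p G x y) :=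
    fun hx hy => KStar.rep_C2 hU Φ ginv p G hp hG hx hy
  have C3 : ∀ {F F' : (Fin n → ℂ) → ℂ} {x y : KStar.Sm U}, KStar.Rep F x → KStar.Rep F' y →
      KStar.Rep (C3top n Φ ginv F F') (KStar.aC3 (KStar.Pd hU) (KStar.Bd hU) p G x y) :=
    fun hx hy => KStar.rep_C3 hU Φ ginv p G hp hG hx hy
  interval_cases r
  · simp [Dop, mul_assoc]
  · simp only [Finset.sum_range_succ, Finset.sum_range_zero, zero_add, Dop]
    have L := ((C1 ha hb).mul hc).add (C1 (ha.mul hb) hc)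
    have R := (ha.mul (C1 hb hc)).add (C1 ha (hb.mul hc))
    rw [KStar.aAssoc1] at R
    exact (L ⟨z, hz⟩).trans (R ⟨z, hz⟩).symm
  · simp only [Finset.sum_range_succ, Finset.sum_range_zero, zero_add, Dop]
    have L := (((C2 ha hb).mul hc).add (C1 (C1 ha hb) hc)).add (C2 (ha.mul hb) hc)
    have R := ((ha.mul (C2 hb hc)).add (C1 ha (C1 hb hc))).add (C2 ha (hb.mul hc))
    rw [KStar.aAssoc2 _ _ _ _ hPP hBB hBP h1 h2] at R
    exact (L ⟨z, hz⟩).trans (R ⟨z, hz⟩).symm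
  · simp only [Finset.sum_range_succ, Finset.sum_range_zero, zero_add, Dop]
    have L := ((((C3 ha hb).mul hc).add (C1 (C2 ha hb) hc)).add (C2 (C1 ha hb) hc)).add
      (C3 (ha.mul hb) hc)
    have R := (((ha.mul (C3 hb hc)).add (C1 ha (C2 hb hc))).add (C2 ha (C1 hb hc))).add
      (C3 ha (hb.mul hc))
    rw [KStar.aAssoc3 _ _ _ _ hPP hBB hBP h1 h2] at R
    exact (L ⟨z, hz⟩).trans (R ⟨z, hz⟩).symm
end
end
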